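/- arXiv:2104.03457 — 4 statements merged into one kernel-verified Lean document; each statement's English description precedes it below -/
import Mathlib

section
/- Let e = 2m with m ≥ 1 and suppose e/s is even. For every α ∈ F_q with α ≠ 0, the Weil sum satisfies: S(α, 0) = (-1)^{m/s} p^m if α^{(q-1)/(p^s+1)} ≠ (-1)^{m/s} (equality taken in F_q), and S(α, 0) = (-1)^{m/s+1} p^{m+s} if α^{(q-1)/(p^s+1)} = (-1)^{m/s}. -/
open scoped BigOperators

noncomputable section

/-- The primitive `p`-th root of unity `ζ_p = exp(2πi/p)`. -/
def zetaP (p : ℕ) : ℂ := Complex.exp (2 * Real.pi * Complex.I / p)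

/-- The absolute trace map from `F_q = GF(p^e)` onto `F_p`. -/
def tr (p e : ℕ) [Fact p.Prime] (x : GaloisField p e) : ZMod p :=
  Algebra.trace (ZMod p) (GaloisField p e) x

/-- The Weil sum `S(α, β) = Σ_{x ∈ F_q} ζ_p^{Tr(α x^{p^l+1} + β x)}`. -/
def weilSum (p e l : ℕ) [Fact p.Prime] (α β : GaloisField p e) : ℂ :=
  letI : Fintype (GaloisField p e) := Fintype.ofFinite _
  ∑ x : GaloisField p e, zetaP p ^ (tr p e (α * x ^ (p ^ l + 1) + β * x)).val

/- The quadratic character `η` of `F_p`, integer-valued: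
`η(0) = 0`, `η(x) = 1` for nonzero squares, `η(x) = -1` for nonsquares. -/
open Classical in
def eta (p : ℕ) (x : ZMod p) : ℤ :=
  if x = 0 then 0 else if IsSquare x then 1 else -1

/- The cyclotomic classes of order 2 in `F_p^*`: `cyc p 0` is the set of nonzero
squares `C_0^{(2,p)}`, and `cyc p 1` is the set of nonsquares `C_1^{(2,p)}`. -/
open Classical in
def cyc (p : ℕ) [Fact p.Prime] (i : ℕ) : Finset (ZMod p) :=
  Finset.univ.filter (fun x => x ≠ 0 ∧ (if i = 0 then IsSquare x else ¬ IsSquare x))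

/-- `ψ_3(a) = ((p-1)/2) p^{e-3} Σ_{z1 ∈ F_p^*} ζ_p^{-z1} Σ_{z3 ∈ F_p^*} S(z1, a z3)`. -/
def psi3 (p e l : ℕ) [Fact p.Prime] (a : GaloisField p e) : ℂ :=
  ((p : ℂ) - 1) / 2 * (p : ℂ) ^ ((e : ℤ) - 3) *
    ∑ z1 ∈ ({0}ᶜ : Finset (ZMod p)), zetaP p ^ (-z1).val *
      ∑ z3 ∈ ({0}ᶜ : Finset (ZMod p)),
        weilSum p e l (algebraMap (ZMod p) (GaloisField p e) z1)
          (a * algebraMap (ZMod p) (GaloisField p e) z3)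

/-- `ψ_4^{(i)}(a, b) = p^{e-3} Σ_{c ∈ C_i} Σ_{z1 ∈ F_p^*} ζ_p^{-z1}
      Σ_{z2 ∈ F_p^*} ζ_p^{-c z2} S(z1, -a b⁻¹ z2)`, for `b ∈ F_p^*`. -/
def psi4 (p e l : ℕ) [Fact p.Prime] (i : ℕ) (a : GaloisField p e) (b : ZMod p) : ℂ :=
  (p : ℂ) ^ ((e : ℤ) - 3) *
    ∑ c ∈ cyc p i, ∑ z1 ∈ ({0}ᶜ : Finset (ZMod p)), zetaP p ^ (-z1).val *
      ∑ z2 ∈ ({0}ᶜ : Finset (ZMod p)), zetaP p ^ (-(c * z2)).val *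
        weilSum p e l (algebraMap (ZMod p) (GaloisField p e) z1)
          (-a * algebraMap (ZMod p) (GaloisField p e) (b⁻¹ * z2))

/-- `T_i(a,b) = |{(x1,x2) ∈ F_q² : Tr(x1^{p^l+1}) = 1, Tr(x2) ∈ C_i, Tr(a x1 + b x2) = 0}|`. -/
def Tcount (p e l : ℕ) [Fact p.Prime] (i : ℕ) (a b : GaloisField p e) : ℕ :=
  Nat.card {x : GaloisField p e × GaloisField p e //
    tr p e (x.1 ^ (p ^ l + 1)) = 1 ∧ tr p e x.2 ∈ cyc p i ∧ tr p e (a * x.1 + b * x.2) = 0}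

/-- The defining set `D_i = {(x1,x2) ∈ F_q² : Tr(x1^{p^l+1}) = 1, Tr(x2) ∈ C_i^{(2,p)}}`. -/
def Dset (p e l : ℕ) [Fact p.Prime] (i : ℕ) : Set (GaloisField p e × GaloisField p e) :=
  {x | tr p e (x.1 ^ (p ^ l + 1)) = 1 ∧ tr p e x.2 ∈ cyc p i}

/-- The codeword of `C_{D_i}` indexed by `(a, b) ∈ F_q²`:
the vector `(Tr(a x1 + b x2))_{(x1,x2) ∈ D_i}`. -/
def codeword (p e l : ℕ) [Fact p.Prime] (i : ℕ) (a b : GaloisField p e) :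
    Dset p e l i → ZMod p :=
  fun x => tr p e (a * x.1.1 + b * x.1.2)

/-- The linear code `C_{D_i} = {(Tr(a x1 + b x2))_{(x1,x2) ∈ D_i} : a, b ∈ F_q}`. -/
def code (p e l : ℕ) [Fact p.Prime] (i : ℕ) : Set (Dset p e l i → ZMod p) :=
  Set.range (fun ab : GaloisField p e × GaloisField p e => codeword p e l i ab.1 ab.2)

/-- The Hamming weight of a vector: the number of nonzero coordinates. -/
def wt {ι : Type*} {p : ℕ} (c : ι → ZMod p) : ℕ := Nat.card {x : ι // c x ≠ 0}

/-- Range of the power map in a cyclic group. -/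
theorem aux_range_gcd (G : Type*) [CommGroup G] [IsCyclic G] [Finite G] (a : ℕ) :
    (powMonoidHom a : G →* G).range = (powMonoidHom ((Nat.card G).gcd a) : G →* G).range := by
  apply Subgroup.eq_of_le_of_card_ge
  · rintro _ ⟨x, rfl⟩
    obtain ⟨t, ht⟩ := Nat.gcd_dvd_right (Nat.card G) a
    refine ⟨x ^ t, ?_⟩
    simp only [powMonoidHom_apply]
    rw [← pow_mul, mul_comm, ← ht]
  · rw [IsCyclic.card_powMonoidHom_range, IsCyclic.card_powMonoidHom_range]
    simp

theorem aux_pow_iff (G : Type*) [CommGroup G] [IsCyclic G] [Finite G] (d M : ℕ)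
    (hd : Nat.card G = d * M) (x : G) : (∃ u, u ^ d = x) ↔ x ^ M = 1 := by
  have hpos : 0 < Nat.card G := Nat.card_pos
  have hd0 : 0 < d := Nat.pos_of_ne_zero (by rintro rfl; rw [zero_mul] at hd; omega)
  have h : (powMonoidHom d : G →* G).range = (powMonoidHom M : G →* G).ker := by
    apply Subgroup.eq_of_le_of_card_ge
    · rintro _ ⟨x, rfl⟩
      simp only [powMonoidHom_apply, MonoidHom.mem_ker]
      rw [← pow_mul, ← hd, pow_card_eq_one']
    · rw [IsCyclic.card_powMonoidHom_range, IsCyclic.card_powMonoidHom_ker, hd]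
      simp [Nat.mul_div_cancel_left _ hd0]
  have := congrArg (fun H => x ∈ H) h
  simpa [MonoidHom.mem_ker, MonoidHom.mem_range] using this

theorem aux_card_fiber (G : Type*) [CommGroup G] [IsCyclic G] [Fintype G] [DecidableEq G]
    (a : ℕ) (c : G) (hc : ∃ u, u ^ a = c) :
    (Finset.univ.filter (fun u : G => u ^ a = c)).card = (Nat.card G).gcd a := by
  have := MonoidHom.card_fiber_eq_of_mem_range (powMonoidHom a : G →* G) (x := c) (y := 1)
    hc ⟨1, by simp⟩
  simp only [powMonoidHom_apply] at this
  rw [this, ← IsCyclic.card_powMonoidHom_ker]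
  exact (Nat.subtype_card _ (by intro x; simp [MonoidHom.mem_ker])).symm

open Classical in
theorem aux_sum_pow (G : Type*) [CommGroup G] [IsCyclic G] [Fintype G] (f : G → ℂ) (a : ℕ) :
    ∑ u : G, f (u ^ a) = ((Nat.card G).gcd a : ℂ) *
      ∑ b ∈ Finset.univ.filter (fun b : G => ∃ u : G, u ^ ((Nat.card G).gcd a) = b),
        f b := by
  have hr : ∀ b : G, (∃ u : G, u ^ a = b) ↔ ∃ u : G, u ^ ((Nat.card G).gcd a) = b := by
    intro b
    have := congrArg (fun H => b ∈ H) (aux_range_gcd G a)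
    simpa [MonoidHom.mem_range] using this
  simp_rw [← hr]
  rw [Finset.mul_sum, Finset.sum_comp f (fun u : G => u ^ a)]
  apply Finset.sum_congr
  · ext b; simp [MonoidHom.mem_range]
  · intro b hb
    rw [aux_card_fiber G a b (by simpa using hb)]
    simp

theorem aux_sum_units (F : Type*) [Field F] [Fintype F] [DecidableEq F] (f : F → ℂ) :
    ∑ x : F, f x = f 0 + ∑ u : Fˣ, f u := by
  rw [Fintype.sum_eq_add_sum_subtype_ne f 0]
  congr 1
  exact (Equiv.sum_comp unitsEquivNeZero (fun x : {x : F // x ≠ 0} => f x)).symm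

theorem aux_sq_sum (F : Type*) [Field F] [Fintype F] [DecidableEq F] (Q N : ℕ)
    (hN : Odd N) (frob : ∀ x y : F, (x + y) ^ Q = x ^ Q + y ^ Q)
    (hbij : Function.Bijective (fun x : F => x ^ Q))
    (χ : AddChar F ℂ) (hχ : χ.IsPrimitive) (hχQ : ∀ x, χ (x ^ Q) = χ x)
    (hχN : ∀ x, χ x ^ N = 1) (α : F) :
    (∑ x, χ (α * x ^ (Q + 1))) * (∑ x, χ (-(α * x ^ (Q + 1)))) =
      (Fintype.card F : ℂ) *
        ((Finset.univ.filter (fun x : F => α ^ Q * x ^ (Q ^ 2) + α * x = 0)).card : ℂ) := by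
  have key : ∀ x : F, ∑ y, χ (α * (x + y) ^ (Q + 1)) * χ (-(α * y ^ (Q + 1))) =
      if α ^ Q * x ^ (Q ^ 2) + α * x = 0 then (Fintype.card F : ℂ) else 0 := by
    intro x
    have h1 : ∀ y, χ (α * (x + y) ^ (Q + 1)) * χ (-(α * y ^ (Q + 1))) =
        χ (α * x ^ (Q + 1)) * χ (y ^ Q * (α ^ Q * x ^ (Q ^ 2) + α * x)) := by
      intro y
      rw [← AddChar.map_add_eq_mul]
      have e1 : α * (x + y) ^ (Q + 1) + -(α * y ^ (Q + 1)) =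
        α * x ^ (Q + 1) + (α * x ^ Q * y + α * x * y ^ Q) := by
        rw [pow_succ, frob]; ring
      have e2 : y ^ Q * (α ^ Q * x ^ (Q ^ 2) + α * x) =
          (α * x ^ Q * y) ^ Q + α * x * y ^ Q := by
        ring
      rw [e1, e2, AddChar.map_add_eq_mul, AddChar.map_add_eq_mul, AddChar.map_add_eq_mul, hχQ]
    simp_rw [h1]
    rw [← Finset.mul_sum,
      hbij.sum_comp (fun y => χ (y * (α ^ Q * x ^ (Q ^ 2) + α * x))), AddChar.sum_mulShift _ hχ]
    split_ifs with h
    · have hc : (α * x ^ (Q + 1)) ^ Q = -(α * x ^ (Q + 1)) := by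
        have : (α * x ^ (Q + 1)) ^ Q = x ^ Q * (α ^ Q * x ^ (Q ^ 2)) := by ring
        rw [this, eq_neg_of_add_eq_zero_left h]; ring
      have h2 : χ (α * x ^ (Q + 1)) ^ 2 = 1 := by
        have := hχQ (α * x ^ (Q + 1))
        rw [hc] at this
        rw [pow_two]; nth_rewrite 1 [← this]
        rw [← AddChar.map_add_eq_mul]; simp
      have h3 : χ (α * x ^ (Q + 1)) = 1 := by
        obtain ⟨t, ht⟩ := hN
        have := hχN (α * x ^ (Q + 1))
        rwa [ht, pow_succ, pow_mul, h2, one_pow, one_mul] at this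
      rw [h3, one_mul]
    · simp
  rw [Finset.sum_mul_sum, Finset.sum_comm]
  have h4 : ∀ y : F, ∑ x, χ (α * x ^ (Q + 1)) * χ (-(α * y ^ (Q + 1))) =
      ∑ x, χ (α * (x + y) ^ (Q + 1)) * χ (-(α * y ^ (Q + 1))) := fun y =>
    (Equiv.sum_comp (Equiv.addRight y)
      (fun x => χ (α * x ^ (Q + 1)) * χ (-(α * y ^ (Q + 1))))).symm
  simp_rw [h4]
  rw [Finset.sum_comm]
  simp_rw [key]
  rw [← Finset.sum_filter, Finset.sum_const, nsmul_eq_mul, mul_comm]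

theorem aux_arith (Q k : ℕ) (hQ : Odd Q) : ∃ M : ℕ, Q ^ (2 * k) - 1 = (Q ^ 2 - 1) * M ∧
    (Odd M ↔ Odd k) := by
  refine ⟨∑ i ∈ Finset.range k, (Q ^ 2) ^ i, ?_, ?_⟩
  · have h1 : 1 ≤ Q ^ 2 := Nat.one_le_pow _ _ hQ.pos
    have h2 : 1 ≤ Q ^ (2 * k) := Nat.one_le_pow _ _ hQ.pos
    have := mul_geom_sum ((Q : ℤ) ^ 2) k
    zify [h1, h2]
    rw [this, pow_mul]
  · rw [Finset.odd_sum_iff_odd_card_odd, Finset.filter_true_of_mem, Finset.card_range]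
    intro i _
    exact (hQ.pow).pow

theorem aux_card_K (F : Type*) [Field F] [Fintype F] [DecidableEq F] (Q k : ℕ)
    (hQ : Odd Q) (hQ3 : 3 ≤ Q) (hF : Fintype.card F = Q ^ (2 * k)) (α : F) (hα : α ≠ 0) :
    (Finset.univ.filter (fun x : F => α ^ Q * x ^ (Q ^ 2) + α * x = 0)).card =
      if α ^ ((Q ^ (2 * k) - 1) / (Q + 1)) = (-1) ^ k then Q ^ 2 else 1 := by
  obtain ⟨M, hM, hMk⟩ := aux_arith Q k hQ
  have hcard : Nat.card Fˣ = (Q ^ 2 - 1) * M := by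
    rw [Nat.card_eq_fintype_card, Fintype.card_units, hF, hM]
  have hQ2 : Q ^ 2 - 1 = (Q + 1) * (Q - 1) := by
    have := Nat.sq_sub_sq Q 1
    simpa using this
  have hdiv : (Q ^ (2 * k) - 1) / (Q + 1) = (Q - 1) * M := by
    rw [hM, hQ2, mul_assoc, Nat.mul_div_cancel_left _ (by omega)]
  set a : Fˣ := Units.mk0 α hα with ha
  set c : Fˣ := -(a ^ (Q - 1))⁻¹ with hc
  have hQ1 : Q - 1 + 1 = Q := by omega
  have hQQ : Q ^ 2 - 1 + 1 = Q ^ 2 := Nat.sub_add_cancel (Nat.one_le_pow _ _ hQ.pos)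
  have hunit : ∀ u : Fˣ, α ^ Q * (u : F) ^ (Q ^ 2) + α * u = 0 ↔ u ^ (Q ^ 2 - 1) = c := by
    intro u
    have e1 : α ^ Q * (u : F) ^ (Q ^ 2) + α * u =
        (α * u) * (α ^ (Q - 1) * (u : F) ^ (Q ^ 2 - 1) + 1) := by
      have f1 : α ^ Q = α ^ (Q - 1) * α := by rw [← pow_succ, hQ1]
      have f2 : (u : F) ^ (Q ^ 2) = (u : F) ^ (Q ^ 2 - 1) * u := by rw [← pow_succ, hQQ]
      rw [f1, f2]
      ring
    rw [e1, mul_eq_zero_iff_left (mul_ne_zero hα u.ne_zero), hc, Units.ext_iff]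
    have hz : α ^ (Q - 1) ≠ 0 := pow_ne_zero _ hα
    push_cast
    simp only [ha, Units.val_mk0]
    constructor
    · intro h
      field_simp
      linear_combination h
    · intro h
      rw [h]; field_simp; ring
  have hcM : c ^ M = 1 ↔ α ^ ((Q ^ (2 * k) - 1) / (Q + 1)) = (-1) ^ k := by
    rw [hdiv, pow_mul]
    have e2 : c ^ M = (-1) ^ k * ((a ^ (Q - 1)) ^ M)⁻¹ := by
      rw [hc, neg_pow, inv_pow]
      congr 1
      rcases Nat.even_or_odd k with h | h
      · rw [h.neg_one_pow, Even.neg_one_pow]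
        rw [← Nat.not_odd_iff_even] at *; tauto
      · rw [h.neg_one_pow, Odd.neg_one_pow]; tauto
    rw [e2, mul_inv_eq_one, Units.ext_iff, eq_comm]
    push_cast
    rfl
  have hsplit : (Finset.univ.filter (fun x : F => α ^ Q * x ^ (Q ^ 2) + α * x = 0)).card =
      1 + (Finset.univ.filter (fun u : Fˣ => u ^ (Q ^ 2 - 1) = c)).card := by
    have := aux_sum_units F (fun x => if α ^ Q * x ^ (Q ^ 2) + α * x = 0 then 1 else 0)
    simp_rw [hunit] at this
    rw [Finset.sum_boole, Finset.sum_boole, if_pos (by simp [show Q ≠ 0 by omega])] at this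
    exact_mod_cast this
  rw [hsplit]
  split_ifs with h
  · rw [← hcM, ← aux_pow_iff Fˣ _ M hcard] at h
    rw [aux_card_fiber _ _ _ h, hcard, Nat.gcd_mul_right_left]
    omega
  · rw [← hcM, ← aux_pow_iff Fˣ _ M hcard] at h
    rw [Finset.filter_false_of_mem]
    · simp
    · intro u _ hu; exact h ⟨u, hu⟩

theorem aux_sign (Q n : ℕ) (hQ3 : 3 ≤ Q) (S P : ℂ) (hP : IsIntegral ℤ P)
    (hS : S = 1 + (Q + 1) * P) (hS2 : S ^ 2 = ((Q : ℂ) ^ n) ^ 2) :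
    S = (-1) ^ n * (Q : ℂ) ^ n := by
  have main : ∀ ε : ℤ, S = ε * (Q : ℂ) ^ n → ((Q : ℤ) + 1) ∣ ε * (Q : ℤ) ^ n - 1 := by
    intro ε h
    have hQ0 : ((Q : ℚ) + 1) ≠ 0 := by positivity
    have hQ0' : ((Q : ℂ) + 1) ≠ 0 := by exact_mod_cast hQ0
    have hPe : P = algebraMap ℚ ℂ ((ε * (Q : ℚ) ^ n - 1) / (Q + 1)) := by
      simp only [eq_ratCast]
      push_cast
      rw [eq_div_iff hQ0', ← h, hS]; ring
    rw [hPe, isIntegral_algebraMap_iff (algebraMap ℚ ℂ).injective] at hP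
    obtain ⟨y, hy⟩ := IsIntegrallyClosed.isIntegral_iff.1 hP
    refine ⟨y, ?_⟩
    rw [eq_div_iff hQ0] at hy
    have : (y : ℚ) * (Q + 1) = ε * (Q : ℚ) ^ n - 1 := by simpa using hy
    have h2 : y * (Q + 1) = ε * (Q : ℤ) ^ n - 1 := by exact_mod_cast this
    rw [← h2]; ring
  have hmod : ((Q : ℤ) + 1) ∣ (Q : ℤ) ^ n - (-1) ^ n := by
    have := sub_dvd_pow_sub_pow (Q : ℤ) (-1) n
    simpa using this
  have hno : ∀ ε : ℤ, ε * (-1) ^ n = -1 → S = ε * (Q : ℂ) ^ n → False := by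
    intro ε hε h
    have h1 := main ε h
    have h2 := dvd_sub h1 (hmod.mul_left ε)
    have h3 : ε * (Q : ℤ) ^ n - 1 - ε * ((Q : ℤ) ^ n - (-1) ^ n) = -2 := by
      linear_combination hε
    rw [h3, dvd_neg] at h2
    have := Int.le_of_dvd (by norm_num) h2
    omega
  rcases sq_eq_sq_iff_eq_or_eq_neg.1 hS2 with h | h <;>
    rcases Nat.even_or_odd n with hn | hn
  · simpa [hn.neg_one_pow] using h
  · exact (hno 1 (by simp [hn.neg_one_pow]) (by simpa using h)).elim
  · exact (hno (-1) (by simp [hn.neg_one_pow]) (by simpa using h)).elim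
  · simpa [hn.neg_one_pow] using h

theorem aux_core (F : Type*) [Field F] [Fintype F] [DecidableEq F] (Q k N l' : ℕ)
    (hQ : Odd Q) (hQ3 : 3 ≤ Q) (hF : Fintype.card F = Q ^ (2 * k))
    (hgcd : Nat.gcd (Q ^ (2 * k) - 1) l' = Q + 1) (hl' : l' ≠ 0) (hk : k ≠ 0)
    (hN : Odd N) (frob : ∀ x y : F, (x + y) ^ Q = x ^ Q + y ^ Q)
    (hbij : Function.Bijective (fun x : F => x ^ Q))
    (χ : AddChar F ℂ) (hχ : χ.IsPrimitive) (hχQ : ∀ x, χ (x ^ Q) = χ x)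
    (hχN : ∀ x, χ x ^ N = 1) (α : F) (hα : α ≠ 0) :
    (∑ x, χ (α * x ^ l')) =
      if α ^ ((Q ^ (2 * k) - 1) / (Q + 1)) = (-1) ^ k then (-1) ^ (k + 1) * (Q : ℂ) ^ (k + 1)
      else (-1) ^ k * (Q : ℂ) ^ k := by
  classical
  obtain ⟨M, hM, hMk⟩ := aux_arith Q k hQ
  have hcard : Nat.card Fˣ = Q ^ (2 * k) - 1 := by
    rw [Nat.card_eq_fintype_card, Fintype.card_units, hF]
  have hQ2 : Q ^ 2 - 1 = (Q + 1) * (Q - 1) := by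
    have := Nat.sq_sub_sq Q 1
    simpa using this
  have hcard2 : Nat.card Fˣ = (Q + 1) * ((Q - 1) * M) := by
    rw [hcard, hM, hQ2, mul_assoc]
  have hg2 : (Nat.card Fˣ).gcd (Q + 1) = Q + 1 := by
    rw [hcard2, Nat.gcd_mul_right_left]
  set P : ℂ := ∑ b ∈ Finset.univ.filter (fun b : Fˣ => ∃ u : Fˣ, u ^ (Q + 1) = b),
    χ (α * (b : F)) with hPdef
  have hP : IsIntegral ℤ P := by
    apply IsIntegral.sum
    intro b _
    apply IsIntegral.of_pow hN.pos
    rw [hχN]; exact isIntegral_one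
  have hsum : ∀ a : ℕ, a ≠ 0 → (Nat.card Fˣ).gcd a = Q + 1 →
      ∑ x, χ (α * x ^ a) = 1 + (Q + 1) * P := by
    intro a ha h
    rw [aux_sum_units]
    have := aux_sum_pow Fˣ (fun u => χ (α * (u : F))) a
    simp only [h] at this
    push_cast at this
    rw [this]
    simp [ha, hPdef]
  rw [hsum l' hl' (by rw [hcard, hgcd]), ← hsum (Q + 1) (by omega) hg2]
  have hneg : ∑ x, χ (-(α * x ^ (Q + 1))) = ∑ x, χ (α * x ^ (Q + 1)) := by
    obtain ⟨u, hu⟩ := (aux_pow_iff Fˣ _ _ hcard2 (-1)).2 (by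
      rw [pow_mul, Even.neg_one_pow, one_pow]
      obtain ⟨t, ht⟩ := hQ
      exact ⟨t, by omega⟩)
    rw [← Equiv.sum_comp (Equiv.mulLeft₀ (u : F) u.ne_zero) (fun x => χ (α * x ^ (Q + 1)))]
    apply Finset.sum_congr rfl
    intro x _
    have hu' : (u : F) ^ (Q + 1) = -1 := by
      rw [← Units.val_pow_eq_pow_val, hu]; simp
    simp [mul_pow, hu']
  have hsq := aux_sq_sum F Q N hN frob hbij χ hχ hχQ hχN α
  rw [hneg, ← pow_two, aux_card_K F Q k hQ hQ3 hF α hα, hF] at hsq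
  split_ifs at hsq ⊢ with h
  · apply aux_sign Q (k + 1) hQ3 _ P hP (hsum _ (by omega) hg2)
    rw [hsq]; push_cast; ring
  · apply aux_sign Q k hQ3 _ P hP (hsum _ (by omega) hg2)
    rw [hsq]; push_cast; ring

theorem aux_gcd (Q k t : ℕ) (hQ : Odd Q) (ht : Odd t) (hkt : Nat.Coprime t (2 * k)) :
    Nat.gcd (Q ^ (2 * k) - 1) (Q ^ t + 1) = Q + 1 := by
  have h1 : 1 ≤ Q := hQ.pos
  apply Nat.dvd_antisymm
  · set d := Nat.gcd (Q ^ (2 * k) - 1) (Q ^ t + 1) with hd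
    have d1 : d ∣ Q ^ (2 * k) - 1 := Nat.gcd_dvd_left _ _
    have d2 : d ∣ Q ^ t + 1 := Nat.gcd_dvd_right _ _
    have d3 : d ∣ Q ^ (2 * t) - 1 := by
      have := Nat.sq_sub_sq (Q ^ t) 1
      rw [one_pow, ← pow_mul, mul_comm t 2] at this
      rw [this]; exact d2.mul_right _
    have d4 : d ∣ Q ^ 2 - 1 := by
      have := Nat.dvd_gcd d1 d3
      rw [Nat.pow_sub_one_gcd_pow_sub_one, Nat.gcd_mul_left,
        (Nat.Coprime.coprime_mul_left_right hkt).symm.gcd_eq_one] at this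
      simpa using this
    obtain ⟨j, rfl⟩ := ht
    have m1 : Q ^ 2 ≡ 1 [MOD d] :=
      ((Nat.modEq_iff_dvd' (Nat.one_le_pow _ _ h1)).2 d4).symm
    have m2 : Q ^ (2 * j + 1) + 1 ≡ Q + 1 [MOD d] := by
      have := ((m1.pow j).mul_right Q).add_right 1
      rw [← pow_mul, ← pow_succ, one_pow, one_mul] at this
      exact this
    exact (m2.dvd_iff dvd_rfl).1 d2
  · apply Nat.dvd_gcd
    · obtain ⟨M, hM, -⟩ := aux_arith Q k hQ
      have := Nat.sq_sub_sq Q 1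
      rw [hM]
      apply Dvd.dvd.mul_right
      exact ⟨Q - 1, by simpa using this⟩
    · simpa using Odd.nat_add_dvd_pow_add_pow Q 1 ht

/-- values of the Weil sum `S(α, 0)` (Coulter / paper Lemma 3). -/
theorem weilSum_zero_eval (p e l m s : ℕ) [Fact p.Prime] (hp : Odd p)
    (hl : 0 < l) (hm : 1 ≤ m) (he : e = 2 * m) (hs : s = Nat.gcd l e)
    (hes : Even (e / s)) (α : GaloisField p e) (hα : α ≠ 0) :
    (α ^ ((p ^ e - 1) / (p ^ s + 1)) ≠ (-1 : GaloisField p e) ^ (m / s) →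
      weilSum p e l α 0 = (-1 : ℂ) ^ (m / s) * (p : ℂ) ^ m) ∧
    (α ^ ((p ^ e - 1) / (p ^ s + 1)) = (-1 : GaloisField p e) ^ (m / s) →
      weilSum p e l α 0 = (-1 : ℂ) ^ (m / s + 1) * (p : ℂ) ^ (m + s)) := by
  have hpp : p.Prime := Fact.out
  have hp3 : 3 ≤ p := by
    have := hpp.two_le
    obtain ⟨t, ht⟩ := hp
    omega
  have he0 : e ≠ 0 := by omega
  have hs0 : 0 < s := hs ▸ Nat.gcd_pos_of_pos_left _ hl
  have hse : s ∣ e := hs ▸ Nat.gcd_dvd_right _ _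
  obtain ⟨t, ht⟩ : s ∣ l := hs ▸ Nat.gcd_dvd_left _ _
  obtain ⟨k, hk⟩ := hes
  have hek : e = s * (2 * k) := by
    rw [← Nat.mul_div_cancel' hse, hk]; ring
  have hmk : m = s * k := by
    have : 2 * m = 2 * (s * k) := by rw [← he, hek]; ring
    omega
  have hms : m / s = k := by rw [hmk, Nat.mul_div_cancel_left _ hs0]
  have hcop : Nat.Coprime t (2 * k) := by
    have h : s * Nat.gcd t (2 * k) = s * 1 := by
      rw [← Nat.gcd_mul_left, ← ht, ← hek, ← hs, mul_one]
    exact Nat.eq_of_mul_eq_mul_left hs0 h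
  have htodd : Odd t := by
    rw [← Nat.coprime_two_right]
    exact hcop.coprime_mul_right_right
  have hk0 : k ≠ 0 := by rintro rfl; omega
  have hQodd : Odd (p ^ s) := hp.pow
  have hQ3 : 3 ≤ p ^ s := hp3.trans (Nat.le_self_pow hs0.ne' p)
  have hpe : p ^ e = (p ^ s) ^ (2 * k) := by rw [hek, pow_mul]
  have hpl : p ^ l = (p ^ s) ^ t := by rw [ht, pow_mul]
  letI : Fintype (GaloisField p e) := Fintype.ofFinite _
  classical
  have hF : Fintype.card (GaloisField p e) = (p ^ s) ^ (2 * k) := by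
    rw [← hpe, ← Nat.card_eq_fintype_card, GaloisField.card p e he0]
  have hprim : IsPrimitiveRoot (zetaP p) p := Complex.isPrimitiveRoot_exp p hpp.ne_zero
  have hζ : zetaP p ^ p = 1 := hprim.pow_eq_one
  let ψ : AddChar (ZMod p) ℂ := AddChar.zmodChar p hζ
  let χ : AddChar (GaloisField p e) ℂ :=
    ψ.compAddMonoidHom (Algebra.trace (ZMod p) (GaloisField p e)).toAddMonoidHom
  have hχa : ∀ x, χ x = zetaP p ^ (tr p e x).val := fun x => rfl
  have hχprim : χ.IsPrimitive := by
    apply AddChar.IsPrimitive.of_ne_one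
    intro h
    obtain ⟨x, hx⟩ := Algebra.trace_surjective (ZMod p) (GaloisField p e) 1
    have h1 : χ x = 1 := by rw [h]; rfl
    rw [hχa, tr, hx] at h1
    haveI : Fact (1 < p) := ⟨hpp.one_lt⟩
    rw [ZMod.val_one, pow_one] at h1
    exact hprim.ne_one hpp.one_lt h1
  have htrp : ∀ x, tr p e (x ^ p) = tr p e x := by
    intro x
    have := Algebra.trace_eq_of_algEquiv
      (FiniteField.frobeniusAlgEquivOfAlgebraic (ZMod p) (GaloisField p e)) x
    rw [FiniteField.coe_frobeniusAlgEquivOfAlgebraic, ZMod.card] at this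
    exact this
  have htrQ : ∀ (n : ℕ) (x), tr p e (x ^ p ^ n) = tr p e x := by
    intro n
    induction n with
    | zero => intro x; simp
    | succ n ih => intro x; rw [pow_succ, pow_mul, htrp, ih]
  have hχQ : ∀ x, χ (x ^ p ^ s) = χ x := by
    intro x; rw [hχa, hχa, htrQ]
  have hχN : ∀ x, χ x ^ p = 1 := by
    intro x; rw [hχa, ← pow_mul, mul_comm, pow_mul, hζ, one_pow]
  have hbij : Function.Bijective (fun x : GaloisField p e => x ^ p ^ s) :=
    (iterateFrobeniusEquiv (GaloisField p e) p s).bijective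
  have hcore := aux_core (GaloisField p e) (p ^ s) k p (p ^ l + 1) hQodd hQ3 hF
    (by rw [hpl]; exact aux_gcd _ k t hQodd htodd hcop) (by omega) hk0 hp
    (fun x y => add_pow_char_pow x y p s) hbij χ hχprim hχQ hχN α hα
  have hW : weilSum p e l α 0 = ∑ x, χ (α * x ^ (p ^ l + 1)) := by
    unfold weilSum
    simp only [zero_mul, add_zero, hχa]
  rw [hW, hcore, hms, hpe]
  constructor
  · intro h
    rw [if_neg h, hmk, pow_mul]; push_cast; rfl
  · intro h
    rw [if_pos h, show m + s = s * (k + 1) by rw [hmk]; ring, pow_mul]; push_cast; rfl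

end
end

section
/- Let e = 2m with m ≥ 1, suppose e/s is even, and let α, β ∈ F_q with α ≠ 0 and β ≠ 0. Then S(α, β) = 0 unless the equation α^{p^l} X^{p^{2l}} + α X = -β^{p^l} has a solution in F_q. Moreover: (1) if α^{(q-1)/(p^s+1)} ≠ (-1)^{m/s} (equality in F_q), then for every β the equation has a unique solution x_0 in F_q and S(α, β) = (-1)^{m/s} p^m ζ_p^{Tr(-α x_0^{p^l+1})}; (2) if α^{(q-1)/(p^s+1)} = (-1)^{m/s} and the equation is solvable with solution x_0, then S(α, β) = (-1)^{m/s+1} p^{m+s} ζ_p^{Tr(-α x_0^{p^l+1})}. -/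
open scoped BigOperators

noncomputable section

section WeilCore
set_option linter.unusedSectionVars false
variable {F : Type*} [Field F] [Fintype F] [DecidableEq F]

/-- The linearised polynomial. -/
def wLin (P : ℕ) (α x : F) : F := α ^ P * (x ^ P) ^ P + α * x

/-- The Weil sum for an abstract additive character. -/
def wS (ψ : AddChar F ℂ) (P : ℕ) (α β : F) : ℂ :=
  ∑ x : F, ψ (α * x ^ (P + 1) + β * x)

lemma wLin_add {P : ℕ} (hadd : ∀ x y : F, (x + y) ^ P = x ^ P + y ^ P) (α x y : F) :
    wLin P α (x + y) = wLin P α x + wLin P α y := by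
  simp only [wLin, hadd]; ring

lemma wLin_psi_symm {P : ℕ} {ψ : AddChar F ℂ} (hfr : ∀ x : F, ψ (x ^ P) = ψ x) (α x z : F) :
    ψ (z ^ P * wLin P α x) = ψ (x ^ P * wLin P α z) := by
  have h1 : z ^ P * wLin P α x = (α * x ^ P * z) ^ P + α * x * z ^ P := by
    simp only [wLin, mul_pow]; ring
  have h2 : x ^ P * wLin P α z = (α * x * z ^ P) ^ P + α * x ^ P * z := by
    simp only [wLin, mul_pow]; ring
  rw [h1, h2, AddChar.map_add_eq_mul, AddChar.map_add_eq_mul, hfr, hfr, mul_comm]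

/-- `ψ (α (x+y)^(P+1)) = ψ (α x^(P+1)) ψ (α y^(P+1)) ψ(x^P L(y))`. -/
lemma wS_shift {P : ℕ} (hadd : ∀ x y : F, (x + y) ^ P = x ^ P + y ^ P)
    {ψ : AddChar F ℂ} (hfr : ∀ x : F, ψ (x ^ P) = ψ x) (α x y : F) :
    ψ (α * (x + y) ^ (P + 1)) =
      ψ (α * x ^ (P + 1)) * ψ (α * y ^ (P + 1)) * ψ (x ^ P * wLin P α y) := by
  have h1 : α * (x + y) ^ (P + 1) = α * x ^ (P + 1) + α * y ^ (P + 1) +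
      (α * x ^ P * y + α * y ^ P * x) := by
    rw [pow_succ, hadd]; ring
  have h2 : x ^ P * wLin P α y = α * x ^ P * y + (α * y ^ P * x) ^ P := by
    simp only [wLin, mul_pow]; ring
  rw [h1, h2]
  simp only [AddChar.map_add_eq_mul, hfr]

lemma psi_half {p : ℕ} (hp : Odd p) [CharP F p] (ψ : AddChar F ℂ) (t : F)
    (h : ψ t * ψ t = 1) : ψ t = 1 := by
  obtain ⟨k, rfl⟩ := hp
  have h0 : ψ ((2 * k + 1) • t) = 1 := by
    rw [nsmul_eq_mul, CharP.cast_eq_zero, zero_mul, AddChar.map_zero_eq_one]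
  rw [AddChar.map_nsmul_eq_pow, pow_succ, pow_mul, pow_two, h, one_pow, one_mul] at h0
  exact h0

/-- Completing the square. -/
lemma wS_complete {P : ℕ} (hadd : ∀ x y : F, (x + y) ^ P = x ^ P + y ^ P)
    {ψ : AddChar F ℂ} (hfr : ∀ x : F, ψ (x ^ P) = ψ x) (α β a : F)
    (ha : wLin P α a = - β ^ P) :
    wS ψ P α β = ψ (-(α * a ^ (P + 1))) * wS ψ P α 0 := by
  have hneg : ∀ x : F, ψ (x ^ P * wLin P α a) = ψ (-(β * x)) := by
    intro x
    rw [ha]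
    have : x ^ P * -β ^ P = -((β * x) ^ P) := by rw [mul_pow]; ring
    rw [this, AddChar.map_neg_eq_inv, hfr, ← AddChar.map_neg_eq_inv]
  have hsq : ψ (β * a) = ψ (-(α * a ^ (P + 1))) * ψ (-(α * a ^ (P + 1))) := by
    have h2 := hneg a
    have h3 : a ^ P * wLin P α a = (α * a ^ (P + 1)) ^ P + α * a ^ (P + 1) := by
      simp only [wLin, mul_pow, pow_succ]; ring
    rw [h3, AddChar.map_add_eq_mul, hfr, AddChar.map_neg_eq_inv] at h2
    rw [AddChar.map_neg_eq_inv, ← mul_inv, h2, inv_inv]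
  unfold wS
  rw [← Equiv.sum_comp (Equiv.addRight a), Finset.mul_sum]
  refine Finset.sum_congr rfl fun x _ => ?_
  simp only [Equiv.coe_addRight, zero_mul, add_zero]
  rw [AddChar.map_add_eq_mul, wS_shift hadd hfr, hneg, mul_add, AddChar.map_add_eq_mul, hsq]
  have e1 : ψ (-(β * x)) * ψ (β * x) = 1 := by
    rw [← AddChar.map_add_eq_mul]; simp
  have e2 : ψ (α * a ^ (P + 1)) * ψ (-(α * a ^ (P + 1))) = 1 := by
    rw [← AddChar.map_add_eq_mul]; simp
  linear_combination (ψ (α * x ^ (P + 1)) * ψ (-(α * a ^ (P + 1)))) *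
    (ψ (α * a ^ (P + 1)) * ψ (-(α * a ^ (P + 1))) * e1 + e2)

lemma ker_psi {p : ℕ} (hp : Odd p) [CharP F p] {P : ℕ}
    {ψ : AddChar F ℂ} (hfr : ∀ x : F, ψ (x ^ P) = ψ x) (α y : F)
    (hy : wLin P α y = 0) : ψ (α * y ^ (P + 1)) = 1 := by
  apply psi_half hp
  have h3 : y ^ P * wLin P α y = (α * y ^ (P + 1)) ^ P + α * y ^ (P + 1) := by
    simp only [wLin, mul_pow, pow_succ]; ring
  rw [hy, mul_zero] at h3
  calc _ = ψ ((α * y ^ (P + 1)) ^ P + α * y ^ (P + 1)) := by rw [AddChar.map_add_eq_mul, hfr]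
    _ = 1 := by rw [← h3, AddChar.map_zero_eq_one]

lemma sum_psi_pow {P : ℕ} (hbij : Function.Bijective (fun x : F => x ^ P))
    {ψ : AddChar F ℂ} (hprim : ψ.IsPrimitive) (c : F) :
    ∑ x : F, ψ (x ^ P * c) = if c = 0 then (Fintype.card F : ℂ) else 0 := by
  have := AddChar.sum_mulShift c hprim
  push_cast at this
  rw [← this]
  exact Equiv.sum_comp (Equiv.ofBijective _ hbij) (fun x => ψ (x * c))

lemma wS_eq_zero {p : ℕ} (hp : Odd p) [CharP F p] {P : ℕ}
    (hadd : ∀ x y : F, (x + y) ^ P = x ^ P + y ^ P)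
    (hbij : Function.Bijective (fun x : F => x ^ P))
    {ψ : AddChar F ℂ} (hprim : ψ.IsPrimitive) (hfr : ∀ x : F, ψ (x ^ P) = ψ x) (α β : F)
    (hno : ¬ ∃ x, wLin P α x = - β ^ P) : wS ψ P α β = 0 := by
  by_contra hS
  have hker : ∀ y, wLin P α y = 0 → ψ (β * y) = 1 := by
    intro y hy
    have h : wS ψ P α β = wS ψ P α β * ψ (β * y) := by
      conv_lhs => unfold wS
      rw [← Equiv.sum_comp (Equiv.addRight y)]
      unfold wS
      rw [Finset.sum_mul]
      refine Finset.sum_congr rfl fun x _ => ?_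
      simp only [Equiv.coe_addRight]
      rw [AddChar.map_add_eq_mul, wS_shift hadd hfr, hy, ker_psi hp hfr α y hy, mul_add,
        AddChar.map_add_eq_mul, mul_zero, AddChar.map_zero_eq_one, AddChar.map_add_eq_mul]
      ring
    have : wS ψ P α β * (ψ (β * y) - 1) = 0 := by rw [mul_sub, ← h]; ring
    rcases mul_eq_zero.1 this with h | h
    · exact absurd h hS
    · exact sub_eq_zero.1 h
  -- double count
  have h1 : ∑ z : F, ∑ x : F, ψ (z ^ P * (wLin P α x + β ^ P)) = 0 := by
    rw [Finset.sum_comm]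
    refine Finset.sum_eq_zero fun x _ => ?_
    rw [sum_psi_pow hbij hprim, if_neg]
    intro h
    exact hno ⟨x, eq_neg_of_add_eq_zero_left h⟩
  have h2 : ∀ z : F, ∑ x : F, ψ (z ^ P * (wLin P α x + β ^ P)) =
      if wLin P α z = 0 then (Fintype.card F : ℂ) else 0 := by
    intro z
    have : ∀ x : F, ψ (z ^ P * (wLin P α x + β ^ P)) = ψ (x ^ P * wLin P α z) * ψ (β * z) := by
      intro x
      rw [mul_add, AddChar.map_add_eq_mul, wLin_psi_symm hfr, ← mul_pow, hfr, mul_comm z]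
    simp_rw [this]
    rw [← Finset.sum_mul, sum_psi_pow hbij hprim]
    split_ifs with h
    · rw [hker z h, mul_one]
    · simp
  simp_rw [h2] at h1
  rw [← Finset.sum_filter, Finset.sum_const, nsmul_eq_mul] at h1
  have hP : P ≠ 0 := by
    rintro rfl
    exact zero_ne_one (hbij.1 (by simp : (0:F) ^ 0 = 1 ^ 0))
  rcases mul_eq_zero.1 h1 with h | h
  · have h' := Nat.cast_eq_zero.1 h
    rw [Finset.card_eq_zero] at h'
    have : (0 : F) ∈ Finset.univ.filter (fun z : F => wLin P α z = 0) := by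
      rw [Finset.mem_filter]
      simp [wLin, hP]
    rw [h'] at this
    simp at this
  · exact Fintype.card_ne_zero (Nat.cast_eq_zero.1 h)

lemma wS_sq {p : ℕ} (hp : Odd p) [CharP F p] {P : ℕ}
    (hadd : ∀ x y : F, (x + y) ^ P = x ^ P + y ^ P)
    (hbij : Function.Bijective (fun x : F => x ^ P))
    {ψ : AddChar F ℂ} (hprim : ψ.IsPrimitive) (hfr : ∀ x : F, ψ (x ^ P) = ψ x) (α u : F)
    (hu : u ^ (P + 1) = -1) :
    wS ψ P α 0 ^ 2 = Fintype.card F *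
      ((Finset.univ.filter (fun z : F => wLin P α z = 0)).card : ℂ) := by
  have hu0 : u ≠ 0 := by rintro rfl; simp at hu
  have hneg : wS ψ P α 0 = ∑ x : F, ψ (-(α * x ^ (P + 1))) := by
    unfold wS
    rw [← Equiv.sum_comp (Equiv.mulLeft₀ u hu0)]
    refine Finset.sum_congr rfl fun x _ => ?_
    simp [mul_pow, hu]
  rw [sq]
  nth_rewrite 1 [hneg]
  unfold wS
  rw [Finset.sum_mul_sum]
  have h : ∀ x : F, ∑ y : F, ψ (-(α * x ^ (P + 1))) * ψ (α * y ^ (P + 1) + 0 * y) =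
      ∑ y : F, ψ (α * y ^ (P + 1)) * ψ (x ^ P * wLin P α y) := by
    intro x
    rw [← Equiv.sum_comp (Equiv.addLeft x)]
    refine Finset.sum_congr rfl fun y _ => ?_
    simp only [Equiv.coe_addLeft, zero_mul, add_zero]
    rw [wS_shift hadd hfr]
    have e2 : ψ (-(α * x ^ (P + 1))) * ψ (α * x ^ (P + 1)) = 1 := by
      rw [← AddChar.map_add_eq_mul]; simp
    linear_combination (ψ (α * y ^ (P + 1)) * ψ (x ^ P * wLin P α y)) * e2
  simp_rw [h]
  rw [Finset.sum_comm]
  simp_rw [← Finset.mul_sum, sum_psi_pow hbij hprim]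
  rw [Finset.card_filter, Nat.cast_sum, Finset.mul_sum]
  refine Finset.sum_congr rfl fun y _ => ?_
  split_ifs with hy
  · rw [ker_psi hp hfr α y hy]; simp
  · simp

/-- Congruence modulo the gcd. -/
lemma wS_congr {p : ℕ} [Fact p.Prime] [CharP F p] {P : ℕ} (ψ : AddChar F ℂ) (α : F) (d : ℕ)
    (hd : (Fintype.card F - 1).gcd (P + 1) = d) :
    ∃ T : ℂ, IsIntegral ℤ T ∧ wS ψ P α 0 = 1 + d * T := by
  classical
  have hIntg : ∀ x : F, IsIntegral ℤ (ψ x) := by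
    intro x
    refine IsIntegral.of_pow (n := p) (Nat.Prime.pos Fact.out) ?_
    rw [← AddChar.map_nsmul_eq_pow, nsmul_eq_mul, CharP.cast_eq_zero, zero_mul,
      AddChar.map_zero_eq_one]
    exact isIntegral_one
  have hsplit : wS ψ P α 0 = 1 + ∑ x : Fˣ, ψ (α * ((x ^ (P + 1) : Fˣ) : F)) := by
    unfold wS
    rw [← Finset.add_sum_erase _ _ (Finset.mem_univ (0 : F))]
    congr 1
    · simp
    · refine (Finset.sum_bij (fun (x : Fˣ) _ => (x : F)) ?_ ?_ ?_ ?_).symm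
      · intro x _; simp
      · intro x _ y _ h; exact Units.ext h
      · intro y hy
        exact ⟨Units.mk0 y (by simpa using hy), by simp, rfl⟩
      · intro x _; simp
  refine ⟨∑ b ∈ Finset.univ.image (powMonoidHom (P + 1) : Fˣ →* Fˣ), ψ (α * (b : F)),
    IsIntegral.sum _ fun b _ => hIntg _, ?_⟩
  rw [hsplit]
  congr 1
  have := Finset.sum_comp (s := (Finset.univ : Finset Fˣ)) (fun b : Fˣ => ψ (α * (b : F)))
    (powMonoidHom (P + 1) : Fˣ →* Fˣ)
  simp only [powMonoidHom_apply] at this ⊢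
  rw [this, Finset.mul_sum]
  refine Finset.sum_congr rfl fun b hb => ?_
  rw [nsmul_eq_mul]
  congr 2
  have hb' : b ∈ Set.range (powMonoidHom (P + 1) : Fˣ →* Fˣ) := by
    simpa using hb
  have h1 : (1 : Fˣ) ∈ Set.range (powMonoidHom (P + 1) : Fˣ →* Fˣ) := ⟨1, by simp⟩
  have h2 := MonoidHom.card_fiber_eq_of_mem_range (powMonoidHom (P + 1) : Fˣ →* Fˣ) hb' h1
  simp only [powMonoidHom_apply] at h2
  rw [h2]
  have h3 := IsCyclic.card_powMonoidHom_ker (G := Fˣ) (P + 1)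
  rw [Nat.card_eq_fintype_card, Nat.card_eq_fintype_card, Fintype.card_units, hd] at h3
  rw [← h3, Fintype.card_subtype]
  simp [MonoidHom.mem_ker]

lemma exists_pow_eq_of_gcd {n d t : ℕ} (hd : (Fintype.card F - 1).gcd n = d)
    (ht : Fintype.card F - 1 = d * t) (c : F) (hc : c ^ t = 1) : ∃ x : F, x ^ n = c := by
  have hc0 : c ≠ 0 := by
    rintro rfl
    have : t ≠ 0 := by
      rintro rfl
      have := Fintype.one_lt_card (α := F)
      omega
    simp [this] at hc
  have hcard : Nat.card Fˣ = d * t := by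
    rw [Nat.card_eq_fintype_card, Fintype.card_units, ht]
  have hdt : 0 < d * t := hcard ▸ Nat.card_pos
  have h1 := IsCyclic.card_powMonoidHom_range (G := Fˣ) n
  have h2 := IsCyclic.card_powMonoidHom_ker (G := Fˣ) t
  have hle : (powMonoidHom n : Fˣ →* Fˣ).range ≤ (powMonoidHom t : Fˣ →* Fˣ).ker := by
    rintro _ ⟨x, rfl⟩
    rw [MonoidHom.mem_ker]
    simp only [powMonoidHom_apply]
    rw [← pow_mul]
    obtain ⟨r, hr⟩ : d ∣ n := hd ▸ Nat.gcd_dvd_right _ _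
    rw [hr, show d * r * t = (d * t) * r by ring, pow_mul, ← hcard, pow_card_eq_one', one_pow]
  have hdpos : 0 < d := Nat.pos_of_mul_pos_right hdt
  have heq := Subgroup.eq_of_le_of_card_ge hle (by
    rw [h1, h2, hcard, ← ht, hd, ht, Nat.mul_div_cancel_left _ hdpos, Nat.gcd_mul_left_left])
  have : Units.mk0 c hc0 ∈ (powMonoidHom n : Fˣ →* Fˣ).range := by
    rw [heq, MonoidHom.mem_ker]
    ext; simpa using hc
  obtain ⟨x, hx⟩ := this
  exact ⟨x, by simpa using congrArg Units.val hx⟩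

lemma card_fixed (r N : ℕ) (hr : 1 ≤ r) (hd : (Fintype.card F - 1).gcd (r - 1) = N - 1)
    (hN : 1 ≤ N) :
    (Finset.univ.filter (fun u : F => u ^ r = u)).card = N := by
  classical
  have h3 := IsCyclic.card_powMonoidHom_ker (G := Fˣ) (r - 1)
  rw [Nat.card_eq_fintype_card, Nat.card_eq_fintype_card, Fintype.card_units, hd,
    Fintype.card_subtype] at h3
  have h0 : (0 : F) ∈ Finset.univ.filter (fun u : F => u ^ r = u) := by
    simp; omega
  rw [← Finset.card_erase_add_one h0]
  have : ((Finset.univ.filter (fun u : F => u ^ r = u)).erase 0).card = N - 1 := by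
    rw [← h3]
    symm
    refine Finset.card_bij (fun (x : Fˣ) _ => (x : F)) ?_ ?_ ?_
    · intro x hx
      simp only [Finset.mem_filter, Finset.mem_univ, true_and, MonoidHom.mem_ker,
        powMonoidHom_apply] at hx
      simp only [Finset.mem_erase, ne_eq, Units.ne_zero, not_false_eq_true, Finset.mem_filter,
        Finset.mem_univ, true_and]
      obtain ⟨k, rfl⟩ : ∃ k, r = k + 1 := ⟨r - 1, by omega⟩
      simp only [Nat.add_sub_cancel] at hx
      rw [pow_succ, ← Units.val_pow_eq_pow_val, hx]; simp
    · intro x _ y _ h; exact Units.ext h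
    · intro y hy
      simp only [Finset.mem_erase, Finset.mem_filter, Finset.mem_univ, true_and] at hy
      refine ⟨Units.mk0 y hy.1, ?_, rfl⟩
      simp only [Finset.mem_filter, Finset.mem_univ, true_and, MonoidHom.mem_ker,
        powMonoidHom_apply]
      ext
      obtain ⟨k, rfl⟩ : ∃ k, r = k + 1 := ⟨r - 1, by omega⟩
      simp only [Nat.add_sub_cancel]
      have := hy.2
      rw [pow_succ] at this
      simpa using mul_right_cancel₀ hy.1 (this.trans (one_mul y).symm)
  omega


lemma sign_lemma {S T : ℂ} {N d : ℕ} (ε : ℤ) (hε : ε = 1 ∨ ε = -1) (hd : 2 < d)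
    (hN : (d : ℤ) ∣ N - ε) (hT : IsIntegral ℤ T) (hS : S = 1 + d * T)
    (hsq : S ^ 2 = (N : ℂ) ^ 2) : S = ε * N := by
  obtain ⟨δ, hδ, hSδ⟩ : ∃ δ : ℤ, (δ = 1 ∨ δ = -1) ∧ S = δ * N := by
    rcases sq_eq_sq_iff_eq_or_eq_neg.1 hsq with h | h
    · exact ⟨1, Or.inl rfl, by simp [h]⟩
    · exact ⟨-1, Or.inr rfl, by simp [h]⟩
  have hd0 : (d : ℂ) ≠ 0 := by
    have : d ≠ 0 := by omega
    exact_mod_cast this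
  have hTq : T = algebraMap ℚ ℂ (((δ : ℚ) * N - 1) / d) := by
    have : T = ((δ : ℂ) * N - 1) / d := by
      rw [eq_div_iff hd0, ← hSδ, hS]; ring
    rw [this]
    simp
  rw [hTq, isIntegral_algebraMap_iff (algebraMap ℚ ℂ).injective] at hT
  obtain ⟨n, hn⟩ := IsIntegrallyClosed.isIntegral_iff.1 hT
  have hd0' : (d : ℚ) ≠ 0 := by exact_mod_cast hd0
  have hn' : δ * (N : ℤ) - 1 = n * d := by
    rw [eq_div_iff hd0'] at hn
    have : (((n * d : ℤ)) : ℚ) = ((δ * (N : ℤ) - 1 : ℤ) : ℚ) := by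
      push_cast; simpa using hn
    exact_mod_cast this.symm
  have hdvd : (d : ℤ) ∣ δ * ε - 1 := by
    have h1 : (d : ℤ) ∣ δ * N - 1 := ⟨n, by rw [hn']; ring⟩
    have h2 : (d : ℤ) ∣ δ * (N - ε) := hN.mul_left _
    have := dvd_sub h1 h2
    rwa [show δ * (N : ℤ) - 1 - δ * (N - ε) = δ * ε - 1 by ring] at this
  have hpos : δ = ε := by
    rcases hδ with rfl | rfl <;> rcases hε with rfl | rfl
    · rfl
    · have := Int.le_of_dvd (by norm_num) ((dvd_neg).2 hdvd)
      omega
    · have := Int.le_of_dvd (by norm_num) ((dvd_neg).2 hdvd)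
      omega
    · rfl
  rw [hSδ, hpos]

lemma exists_M (Q k : ℕ) (hQ : Odd Q) :
    ∃ M : ℕ, Q ^ (2 * k) = (Q ^ 2 - 1) * M + 1 ∧ (Even M ↔ Even k) := by
  have hQ1 : 1 ≤ Q ^ 2 := Nat.one_le_pow _ _ hQ.pos
  obtain ⟨R, hR⟩ : ∃ R, Q ^ 2 = R + 1 := ⟨Q ^ 2 - 1, by omega⟩
  have hodd : ¬ Even (Q ^ 2) := by
    rw [Nat.not_even_iff_odd]; exact hQ.pow
  induction k with
  | zero => exact ⟨0, by simp, by simp⟩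
  | succ k ih =>
    obtain ⟨M, hM, hpar⟩ := ih
    refine ⟨Q ^ 2 * M + 1, ?_, ?_⟩
    · rw [show 2 * (k + 1) = 2 * k + 2 by ring, pow_add, hM, hR]
      simp only [Nat.add_sub_cancel]; ring
    · rw [Nat.even_add_one, Nat.even_mul, Nat.even_add_one, ← hpar]
      tauto

lemma gcd_P (q P Q j : ℕ) (hQ : Odd Q) (hP : P = Q ^ (2 * j + 1))
    (hg : (q - 1).gcd (P ^ 2 - 1) = Q ^ 2 - 1) : (q - 1).gcd (P + 1) = Q + 1 := by
  have hfac : ∀ a : ℕ, a ^ 2 - 1 = (a + 1) * (a - 1) := by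
    intro a; have := Nat.sq_sub_sq a 1; simpa using this
  have hdvd1 : Q + 1 ∣ P + 1 := by
    rw [hP]
    have := Odd.nat_add_dvd_pow_add_pow Q 1 (n := 2 * j + 1) ⟨j, rfl⟩
    simpa using this
  apply Nat.dvd_antisymm
  · have h1 : (q - 1).gcd (P + 1) ∣ Q ^ 2 - 1 := by
      rw [← hg]
      exact Nat.gcd_dvd_gcd_of_dvd_right _ (by rw [hfac P]; exact Dvd.intro _ rfl)
    have h2 : (q - 1).gcd (P + 1) ∣ P + 1 := Nat.gcd_dvd_right _ _
    obtain ⟨M, hM, -⟩ := exists_M Q j hQ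
    have h3 : P + 1 = (Q ^ 2 - 1) * (M * Q) + (Q + 1) := by
      rw [hP, pow_succ, hM]; ring
    rw [h3] at h2 ⊢
    rw [h3] at h1
    exact (Nat.dvd_add_right (h1.mul_right _)).1 h2
  · refine Nat.dvd_gcd ?_ hdvd1
    have : Q + 1 ∣ Q ^ 2 - 1 := by rw [hfac Q]; exact Dvd.intro _ rfl
    rw [← hg] at this
    exact this.trans (Nat.gcd_dvd_left _ _)

lemma pow_iter (w : F) (R j : ℕ) (h : w ^ R = w) : w ^ (R ^ j) = w := by
  induction j with
  | zero => simp
  | succ j ih => rw [pow_succ, pow_mul, ih, h]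

lemma fixed_gcd (w : F) (r N : ℕ) (hr : 1 ≤ r) (hN : 1 ≤ N)
    (hd : (Fintype.card F - 1).gcd (r - 1) = N - 1) (h : w ^ r = w) : w ^ N = w := by
  by_cases hw : w = 0
  · subst hw; exact zero_pow (by omega)
  have h1 : w ^ (r - 1) = 1 := by
    apply mul_right_cancel₀ hw
    rw [← pow_succ, Nat.sub_add_cancel hr, h, one_mul]
  have h2 := FiniteField.pow_card_sub_one_eq_one w hw
  have h3 : w ^ (N - 1) = 1 := by
    rw [← hd]
    exact orderOf_dvd_iff_pow_eq_one.1
      (Nat.dvd_gcd (orderOf_dvd_of_pow_eq_one h2) (orderOf_dvd_of_pow_eq_one h1))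
  rw [← Nat.sub_add_cancel hN, pow_succ, h3, one_mul]

lemma ker_imp (P Q j k M : ℕ) (hQ : Odd Q) (hP : P = Q ^ (2 * j + 1))
    (hg : (Fintype.card F - 1).gcd (P ^ 2 - 1) = Q ^ 2 - 1)
    (hM : Fintype.card F = (Q ^ 2 - 1) * M + 1) (hpar : Even M ↔ Even k)
    (α x : F) (hα : α ≠ 0) (hx : x ≠ 0) (h : wLin P α x = 0) :
    α ^ ((Q - 1) * M) = (-1) ^ k := by
  have hPpos : 0 < P := hP ▸ pow_pos hQ.pos _
  have hPodd : Odd P := hP ▸ hQ.pow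
  set w := α * x ^ (P + 1) with hw
  have hw0 : w ≠ 0 := mul_ne_zero hα (pow_ne_zero _ hx)
  have hwP : w ^ P = -w := by
    have : w ^ P + w = x ^ P * wLin P α x := by
      simp only [hw, wLin, mul_pow, pow_succ]; ring
    rw [h, mul_zero] at this
    exact eq_neg_of_add_eq_zero_left this
  have hwP2 : w ^ (P ^ 2) = w := by
    rw [sq, pow_mul, hwP, hPodd.neg_pow, hwP, neg_neg]
  have hwQ2 : w ^ (Q ^ 2) = w :=
    fixed_gcd w (P ^ 2) (Q ^ 2) (Nat.one_le_pow _ _ hPpos) (Nat.one_le_pow _ _ hQ.pos) hg hwP2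
  have hwQ : w ^ Q = -w := by
    rw [← hwP, hP, pow_succ, pow_mul, pow_mul Q, pow_iter w _ j hwQ2]
  have hwQ1 : w ^ (Q - 1) = -1 := by
    apply mul_right_cancel₀ hw0
    rw [← pow_succ, Nat.sub_add_cancel hQ.pos, hwQ]; ring
  have h1 : w ^ ((Q - 1) * M) = (-1) ^ k := by
    rw [pow_mul, hwQ1]
    rcases Nat.even_or_odd k with hk | hk
    · rw [hk.neg_one_pow, (hpar.2 hk).neg_one_pow]
    · have : Odd M := by
        rw [← Nat.not_even_iff_odd, hpar, Nat.not_even_iff_odd]; exact hk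
      rw [hk.neg_one_pow, this.neg_one_pow]
  rw [← h1, hw, mul_pow]
  have hgc := gcd_P _ P Q j hQ hP hg
  obtain ⟨r, hr⟩ : Q + 1 ∣ P + 1 := hgc ▸ Nat.gcd_dvd_right _ _
  have hfac : Q ^ 2 - 1 = (Q + 1) * (Q - 1) := by
    have := Nat.sq_sub_sq Q 1; simpa using this
  have : x ^ (P + 1) ^ 1 ≠ 0 := by simp [hx]
  have hone : (x ^ (P + 1)) ^ ((Q - 1) * M) = 1 := by
    rw [← pow_mul, hr, show (Q + 1) * r * ((Q - 1) * M) = ((Q + 1) * (Q - 1) * M) * r by ring,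
      ← hfac, pow_mul, show (Q ^ 2 - 1) * M = Fintype.card F - 1 by omega,
      FiniteField.pow_card_sub_one_eq_one x hx, one_pow]
  rw [hone, mul_one]

lemma exists_neg_one_root (P Q j M : ℕ) (hQ : Odd Q) (hP : P = Q ^ (2 * j + 1))
    (hg : (Fintype.card F - 1).gcd (P ^ 2 - 1) = Q ^ 2 - 1)
    (hM : Fintype.card F = (Q ^ 2 - 1) * M + 1) : ∃ u : F, u ^ (P + 1) = -1 := by
  have hfac : Q ^ 2 - 1 = (Q + 1) * (Q - 1) := by
    have := Nat.sq_sub_sq Q 1; simpa using this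
  refine exists_pow_eq_of_gcd (gcd_P _ P Q j hQ hP hg) (t := (Q - 1) * M) ?_ _ ?_
  · rw [hM, hfac, Nat.add_sub_cancel]; ring
  · apply Even.neg_one_pow
    exact (Nat.Odd.sub_odd hQ odd_one).mul_right _

lemma exists_ker (P Q j k M : ℕ) (hQ : Odd Q) (hP : P = Q ^ (2 * j + 1))
    (hg : (Fintype.card F - 1).gcd (P ^ 2 - 1) = Q ^ 2 - 1)
    (hM : Fintype.card F = (Q ^ 2 - 1) * M + 1) (hpar : Even M ↔ Even k)
    (α : F) (hα : α ≠ 0) (h : α ^ ((Q - 1) * M) = (-1) ^ k) :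
    ∃ x : F, x ≠ 0 ∧ wLin P α x = 0 := by
  have hfac : Q ^ 2 - 1 = (Q + 1) * (Q - 1) := by
    have := Nat.sq_sub_sq Q 1; simpa using this
  have hPodd : Odd P := hP ▸ hQ.pow
  obtain ⟨w, hw⟩ : ∃ w : F, w ^ (Q - 1) = -1 := by
    refine exists_pow_eq_of_gcd (d := Q - 1) ?_ (t := (Q + 1) * M) ?_ _ ?_
    · apply Nat.gcd_eq_right
      rw [hM, hfac, Nat.add_sub_cancel]
      exact ⟨(Q + 1) * M, by ring⟩
    · rw [hM, hfac, Nat.add_sub_cancel]; ring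
    · apply Even.neg_one_pow
      exact (hQ.add_odd odd_one).mul_right _
  have hwQ : w ^ Q = -w := by
    rw [← Nat.sub_add_cancel hQ.pos, pow_succ, hw]; ring
  have hwP : w ^ P = -w := by
    have hwQ2 : w ^ (Q ^ 2) = w := by rw [sq, pow_mul, hwQ, hQ.neg_pow, hwQ, neg_neg]
    rw [hP, pow_succ, pow_mul, pow_mul Q, pow_iter w _ j hwQ2, hwQ]
  have hwM : w ^ ((Q - 1) * M) = (-1) ^ k := by
    rw [pow_mul, hw]
    rcases Nat.even_or_odd k with hk | hk
    · rw [hk.neg_one_pow, (hpar.2 hk).neg_one_pow]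
    · have : Odd M := by
        rw [← Nat.not_even_iff_odd, hpar, Nat.not_even_iff_odd]; exact hk
      rw [hk.neg_one_pow, this.neg_one_pow]
  have hw0 : w ≠ 0 := by
    rintro rfl
    rcases Nat.eq_zero_or_pos (Q - 1) with h0 | h0
    · have := Fintype.one_lt_card (α := F)
      rw [hM, hfac, h0] at this
      simp at this
    · rw [zero_pow h0.ne'] at hw
      exact neg_ne_zero.2 one_ne_zero hw.symm
  obtain ⟨x, hx⟩ := exists_pow_eq_of_gcd (F := F) (gcd_P _ P Q j hQ hP hg) (t := (Q - 1) * M)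
    (by rw [hM, hfac, Nat.add_sub_cancel]; ring) (w / α)
    (by rw [div_pow, h, hwM, div_self]; exact pow_ne_zero _ (neg_ne_zero.2 one_ne_zero))
  have hx0 : x ≠ 0 := by
    rintro rfl
    rw [zero_pow (by omega)] at hx
    exact div_ne_zero hw0 hα hx.symm
  refine ⟨x, hx0, ?_⟩
  have h1 : x ^ P * wLin P α x = w ^ P + w := by
    have : w = α * x ^ (P + 1) := by rw [hx]; field_simp
    rw [this]
    simp only [wLin, mul_pow, pow_succ]; ring
  rw [hwP, neg_add_cancel] at h1
  exact (mul_eq_zero.1 h1).resolve_left (pow_ne_zero _ hx0)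

lemma card_ker (P Q : ℕ) (hQ : 0 < Q) (hP : 0 < P)
    (hg : (Fintype.card F - 1).gcd (P ^ 2 - 1) = Q ^ 2 - 1)
    (α x : F) (hα : α ≠ 0) (hx : x ≠ 0) (h : wLin P α x = 0) :
    (Finset.univ.filter (fun z : F => wLin P α z = 0)).card = Q ^ 2 := by
  rw [← card_fixed (F := F) (P ^ 2) (Q ^ 2) (Nat.one_le_pow _ _ hP) hg (Nat.one_le_pow _ _ hQ)]
  symm
  have key : ∀ u : F, wLin P α (x * u) = α * x * (u - u ^ (P ^ 2)) := by
    intro u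
    have : α ^ P * (x ^ P) ^ P = -(α * x) := eq_neg_of_add_eq_zero_left h
    simp only [wLin, mul_pow]
    rw [← mul_assoc, this, sq, pow_mul]; ring
  refine Finset.card_bij (fun u _ => x * u) ?_ ?_ ?_
  · intro u hu
    simp only [Finset.mem_filter, Finset.mem_univ, true_and] at hu ⊢
    rw [key, hu, sub_self, mul_zero]
  · intro a _ b _ hab
    exact mul_left_cancel₀ hx hab
  · intro z hz
    simp only [Finset.mem_filter, Finset.mem_univ, true_and] at hz
    refine ⟨x⁻¹ * z, ?_, by field_simp⟩
    have hz' : x * (x⁻¹ * z) = z := by field_simp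
    rw [← hz', key] at hz
    simp only [Finset.mem_filter, Finset.mem_univ, true_and]
    exact (sub_eq_zero.1 ((mul_eq_zero.1 hz).resolve_left (mul_ne_zero hα hx))).symm

/-- The core evaluation. -/
theorem weil_core {p : ℕ} [Fact p.Prime] (hp : Odd p) [CharP F p] (P Q j k M : ℕ) (hQ : Odd Q)
    (hQ1 : 1 < Q)
    (hP : P = Q ^ (2 * j + 1))
    (hq : Fintype.card F = Q ^ (2 * k))
    (hg : (Fintype.card F - 1).gcd (P ^ 2 - 1) = Q ^ 2 - 1)
    (hM : Fintype.card F = (Q ^ 2 - 1) * M + 1) (hpar : Even M ↔ Even k)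
    (hadd : ∀ x y : F, (x + y) ^ P = x ^ P + y ^ P)
    (hbij : Function.Bijective (fun x : F => x ^ P))
    {ψ : AddChar F ℂ} (hprim : ψ.IsPrimitive) (hfr : ∀ x : F, ψ (x ^ P) = ψ x) (α β : F)
    (hα : α ≠ 0) :
    ((¬ ∃ x : F, wLin P α x = -β ^ P) → wS ψ P α β = 0) ∧
    (α ^ ((Q - 1) * M) ≠ (-1 : F) ^ k →
      (∃! x₀ : F, wLin P α x₀ = -β ^ P) ∧
      ∀ x₀ : F, wLin P α x₀ = -β ^ P →
        wS ψ P α β = (-1 : ℂ) ^ k * (Q : ℂ) ^ k * ψ (-(α * x₀ ^ (P + 1)))) ∧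
    (α ^ ((Q - 1) * M) = (-1 : F) ^ k →
      ∀ x₀ : F, wLin P α x₀ = -β ^ P →
        wS ψ P α β = (-1 : ℂ) ^ (k + 1) * (Q : ℂ) ^ (k + 1) * ψ (-(α * x₀ ^ (P + 1)))) := by
  obtain ⟨u, hu⟩ := exists_neg_one_root (F := F) P Q j M hQ hP hg hM
  have hPpos : 0 < P := hP ▸ pow_pos hQ.pos _
  have hsq := wS_sq hp hadd hbij hprim hfr α u hu
  obtain ⟨T, hT, hST⟩ := wS_congr (p := p) ψ α _ (gcd_P _ P Q j hQ hP hg)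
  have hval : ∀ a : ℕ, wS ψ P α 0 ^ 2 = ((Q ^ a : ℕ) : ℂ) ^ 2 →
      wS ψ P α 0 = (-1) ^ a * (Q : ℂ) ^ a := by
    intro a ha
    have := sign_lemma ((-1) ^ a) (neg_one_pow_eq_or ℤ a) (by omega) (d := Q + 1) (N := Q ^ a)
      (by
        have := sub_dvd_pow_sub_pow (Q : ℤ) (-1) a
        push_cast
        simpa using this) hT hST ha
    rw [this]; push_cast; rfl
  refine ⟨wS_eq_zero hp hadd hbij hprim hfr α β, ?_, ?_⟩
  · intro hne
    have hker : ∀ x : F, wLin P α x = 0 → x = 0 := by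
      intro x hx
      by_contra hx0
      exact hne (ker_imp P Q j k M hQ hP hg hM hpar α x hα hx0 hx)
    have hinj : Function.Injective (wLin P α) := by
      intro a b hab
      have h1 := wLin_add hadd α (a - b) b
      rw [sub_add_cancel, hab] at h1
      exact sub_eq_zero.1 (hker _ (by simpa using h1))
    refine ⟨(Finite.injective_iff_bijective.1 hinj).existsUnique _, ?_⟩
    intro x₀ hx₀
    have hfil : (Finset.univ.filter (fun z : F => wLin P α z = 0)) = {0} := by
      ext z
      simp only [Finset.mem_filter, Finset.mem_univ, true_and, Finset.mem_singleton]
      refine ⟨hker z, ?_⟩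
      rintro rfl
      simp [wLin, hPpos.ne']
    rw [hfil, hq] at hsq
    rw [wS_complete hadd hfr α β x₀ hx₀, hval k (by rw [hsq]; push_cast; simp; ring), mul_comm]
  · intro heq x₀ hx₀
    obtain ⟨x, hx0, hx⟩ := exists_ker P Q j k M hQ hP hg hM hpar α hα heq
    rw [card_ker P Q hQ.pos hPpos hg α x hα hx0 hx, hq] at hsq
    rw [wS_complete hadd hfr α β x₀ hx₀, hval (k + 1) (by rw [hsq]; push_cast; ring), mul_comm]

end WeilCore

lemma frob_trace (p e : ℕ) [Fact p.Prime] (l : ℕ) (x : GaloisField p e) :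
    tr p e (x ^ p ^ l) = tr p e x := by
  unfold tr
  induction l with
  | zero => simp
  | succ l ih =>
    rw [pow_succ, pow_mul, ← ih]
    have := Algebra.trace_eq_of_algEquiv
      (FiniteField.frobeniusAlgEquiv (ZMod p) (GaloisField p e) p) (x ^ p ^ l)
    simpa using this

lemma zetaP_prim (p : ℕ) [Fact p.Prime] : IsPrimitiveRoot (zetaP p) p :=
  Complex.isPrimitiveRoot_exp p (Nat.Prime.ne_zero Fact.out)

/-- The canonical additive character of the Galois field. -/
def psiG (p e : ℕ) [Fact p.Prime] : AddChar (GaloisField p e) ℂ :=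
  (AddChar.zmodChar p (zetaP_prim p).pow_eq_one).compAddMonoidHom
    (Algebra.trace (ZMod p) (GaloisField p e)).toAddMonoidHom

lemma psiG_apply (p e : ℕ) [Fact p.Prime] (x : GaloisField p e) :
    psiG p e x = zetaP p ^ (tr p e x).val := rfl

lemma psiG_prim (p e : ℕ) [Fact p.Prime] : (psiG p e).IsPrimitive := by
  apply AddChar.IsPrimitive.of_ne_one
  intro h
  obtain ⟨a, ha⟩ := Algebra.trace_surjective (ZMod p) (GaloisField p e) 1
  have h1 : psiG p e a = 1 := by rw [h]; rfl
  have h2 := (AddChar.zmodChar_primitive_of_primitive_root p (zetaP_prim p)).zmod_char_eq_one_iff p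
    (1 : ZMod p)
  have h3 : (AddChar.zmodChar p (zetaP_prim p).pow_eq_one) (1 : ZMod p) = 1 := by
    rw [← ha]; exact h1
  exact one_ne_zero (h2.1 h3)

/-- values of the Weil sum `S(α, β)` for `β ≠ 0` (Coulter / paper Lemma 4). -/
theorem weilSum_eval (p e l m s : ℕ) [Fact p.Prime] (hp : Odd p)
    (hl : 0 < l) (hm : 1 ≤ m) (he : e = 2 * m) (hs : s = Nat.gcd l e)
    (hes : Even (e / s)) (α β : GaloisField p e) (hα : α ≠ 0) (hβ : β ≠ 0) :
    ((¬ ∃ x : GaloisField p e, α ^ p ^ l * x ^ p ^ (2 * l) + α * x = -β ^ p ^ l) →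
      weilSum p e l α β = 0) ∧
    (α ^ ((p ^ e - 1) / (p ^ s + 1)) ≠ (-1 : GaloisField p e) ^ (m / s) →
      (∃! x₀ : GaloisField p e, α ^ p ^ l * x₀ ^ p ^ (2 * l) + α * x₀ = -β ^ p ^ l) ∧
      ∀ x₀ : GaloisField p e, α ^ p ^ l * x₀ ^ p ^ (2 * l) + α * x₀ = -β ^ p ^ l →
        weilSum p e l α β =
          (-1 : ℂ) ^ (m / s) * (p : ℂ) ^ m *
            zetaP p ^ (tr p e (-(α * x₀ ^ (p ^ l + 1)))).val) ∧
    (α ^ ((p ^ e - 1) / (p ^ s + 1)) = (-1 : GaloisField p e) ^ (m / s) →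
      ∀ x₀ : GaloisField p e, α ^ p ^ l * x₀ ^ p ^ (2 * l) + α * x₀ = -β ^ p ^ l →
        weilSum p e l α β =
          (-1 : ℂ) ^ (m / s + 1) * (p : ℂ) ^ (m + s) *
            zetaP p ^ (tr p e (-(α * x₀ ^ (p ^ l + 1)))).val) := by
  classical
  let _ : Fintype (GaloisField p e) := Fintype.ofFinite _
  have hpp : p.Prime := Fact.out
  have hs0 : 0 < s := hs ▸ Nat.gcd_pos_of_pos_left _ hl
  have hsl : s ∣ l := hs ▸ Nat.gcd_dvd_left _ _
  have hse : s ∣ e := hs ▸ Nat.gcd_dvd_right _ _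
  obtain ⟨k, hk⟩ : ∃ k, m = s * k := by
    obtain ⟨t, ht⟩ := hes
    refine ⟨t, ?_⟩
    have h1 := Nat.mul_div_cancel' hse
    rw [ht, he] at h1
    have : s * (t + t) = 2 * (s * t) := by ring
    omega
  have hmk : m / s = k := by rw [hk, Nat.mul_div_cancel_left _ hs0]
  obtain ⟨j, hj⟩ : ∃ j, l = s * (2 * j + 1) := by
    obtain ⟨t, ht⟩ := hsl
    rcases Nat.even_or_odd t with ⟨r, hr⟩ | ⟨r, hr⟩
    · exfalso
      have h1 : s * 2 ∣ Nat.gcd l e := by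
        refine Nat.dvd_gcd ⟨r, ?_⟩ ⟨k, ?_⟩
        · rw [ht, hr]; ring
        · rw [he, hk]; ring
      rw [← hs] at h1
      have := Nat.le_of_dvd hs0 h1
      omega
    · exact ⟨r, by rw [ht, hr]⟩
  have hcard : Fintype.card (GaloisField p e) = p ^ e := by
    rw [← Nat.card_eq_fintype_card, GaloisField.card p e (by omega)]
  have hQ : Odd (p ^ s) := hp.pow
  have hQ1 : 1 < p ^ s := Nat.one_lt_pow hs0.ne' hpp.one_lt
  have hP : p ^ l = (p ^ s) ^ (2 * j + 1) := by rw [← pow_mul, ← hj]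
  have hq : Fintype.card (GaloisField p e) = (p ^ s) ^ (2 * k) := by
    rw [hcard, ← pow_mul, he, hk]; congr 1; ring
  have hg : (Fintype.card (GaloisField p e) - 1).gcd ((p ^ l) ^ 2 - 1) = (p ^ s) ^ 2 - 1 := by
    rw [hcard, ← pow_mul, ← pow_mul, Nat.pow_sub_one_gcd_pow_sub_one]
    congr 2
    have h1 : Nat.gcd m l = s := by
      apply Nat.dvd_antisymm
      · rw [hs]
        exact Nat.dvd_gcd (Nat.gcd_dvd_right _ _)
          (he ▸ (Nat.gcd_dvd_left m l).mul_left 2)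
      · exact Nat.dvd_gcd ⟨k, hk⟩ hsl
    rw [he, mul_comm 2 m, Nat.gcd_mul_right, h1]
  obtain ⟨M, hM, hpar⟩ := exists_M (p ^ s) k hQ
  rw [← hq] at hM
  have hfac : (p ^ s) ^ 2 - 1 = (p ^ s + 1) * (p ^ s - 1) := by
    have := Nat.sq_sub_sq (p ^ s) 1; simpa using this
  have hexp : (p ^ e - 1) / (p ^ s + 1) = (p ^ s - 1) * M := by
    rw [← hcard, hM, hfac, Nat.add_sub_cancel, mul_assoc, Nat.mul_div_cancel_left _ (by omega)]
  have hadd : ∀ x y : GaloisField p e, (x + y) ^ p ^ l = x ^ p ^ l + y ^ p ^ l :=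
    fun x y => add_pow_char_pow x y p l
  have hbij : Function.Bijective (fun x : GaloisField p e => x ^ p ^ l) :=
    Finite.injective_iff_bijective.1 (iterateFrobenius_inj (GaloisField p e) p l)
  have hlin : ∀ x : GaloisField p e,
      α ^ p ^ l * x ^ p ^ (2 * l) + α * x = wLin (p ^ l) α x := by
    intro x
    rw [wLin, ← pow_mul, ← pow_add, two_mul]
  have hW : weilSum p e l α β = wS (psiG p e) (p ^ l) α β := rfl
  have hpm : (p : ℂ) ^ m = ((p ^ s : ℕ) : ℂ) ^ k := by push_cast; rw [← pow_mul, hk]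
  have hpms : (p : ℂ) ^ (m + s) = ((p ^ s : ℕ) : ℂ) ^ (k + 1) := by
    push_cast; rw [← pow_mul, hk, mul_add, mul_one]
  simp only [hlin, hW, hexp, hmk, hpm, hpms, ← psiG_apply]
  exact weil_core hp (p ^ l) (p ^ s) j k M hQ hQ1 hP hq hg hM hpar hadd hbij (psiG_prim p e)
    (fun x => by rw [psiG_apply, psiG_apply, frob_trace]) α β hα

end
end

section
/- Let p ≡ 3 (mod 4), let e = 2m with m ≥ 1, and suppose s divides m. Then for i = 0, 1, the cardinality n_i = |{(x_1, x_2) ∈ F_q^2 : Tr(x_1^{p^l+1}) = 1 and Tr(x_2) ∈ C_i^{(2,p)}}| equals ((p-1)/2)(p^{2e-2} + p^{e+m-2}) if m/s ≡ 1 (mod 2), and equals ((p-1)/2)(p^{2e-2} + p^{e+m+s-2}) if m/s ≡ 0 (mod 2). -/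
open scoped BigOperators

noncomputable section

namespace LenAux

lemma exists_root {G : Type*} [CommGroup G] [Finite G] [IsCyclic G] (k d : ℕ)
    (hc : Nat.card G = k * d) (a : G) (ha : a ^ k = 1) : ∃ t : G, t ^ d = a := by
  have hpos : 0 < Nat.card G := Nat.card_pos
  have hd : 0 < d := Nat.pos_of_ne_zero (by rintro rfl; simp at hc; omega)
  have hle : (powMonoidHom d : G →* G).range ≤ (powMonoidHom k : G →* G).ker := by
    rintro _ ⟨t, rfl⟩
    rw [MonoidHom.mem_ker]
    simp only [powMonoidHom_apply]
    rw [← pow_mul, mul_comm, ← hc]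
    exact pow_card_eq_one'
  have heq := Subgroup.eq_of_le_of_card_ge hle (by
    rw [IsCyclic.card_powMonoidHom_ker, IsCyclic.card_powMonoidHom_range, hc]
    simp [hd])
  have : a ∈ (powMonoidHom k : G →* G).ker := by
    rw [MonoidHom.mem_ker]; simpa using ha
  rw [← heq] at this
  obtain ⟨t, ht⟩ := this
  exact ⟨t, by simpa using ht⟩

open Classical in
lemma dvd_card_fib {G : Type*} [CommGroup G] [Fintype G] [IsCyclic G] (k d : ℕ)
    (hc : Nat.card G = k * d) (P : G → Prop) [DecidablePred P] (hP : ∀ a b : G, a ^ d = b ^ d → P a → P b) :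
    d ∣ (Finset.univ.filter P).card := by
  rw [Finset.card_eq_sum_card_image (fun x : G => x ^ d)]
  refine Finset.dvd_sum ?_
  intro b hb
  obtain ⟨a, ha, rfl⟩ := Finset.mem_image.mp hb
  have hPa : P a := by simpa using ha
  have h1 : ({x ∈ Finset.univ.filter P | x ^ d = a ^ d} : Finset G) =
      Finset.univ.filter (fun x => x ∈ (powMonoidHom d : G →* G) ⁻¹' {a ^ d}) := by
    ext x
    simp only [Finset.mem_filter, Finset.mem_univ, true_and, Set.mem_preimage,
      Set.mem_singleton_iff, powMonoidHom_apply]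
    exact ⟨fun h => h.2, fun h => ⟨hP a x h.symm hPa, h⟩⟩
  have h2 : (Finset.univ.filter (fun x : G => x ^ d = a ^ d)).card
      = (Finset.univ.filter (fun x : G => x ^ d = 1)).card := by
    refine Finset.card_bij' (fun x _ => x * a⁻¹) (fun x _ => x * a) ?_ ?_ ?_ ?_ <;>
      simp +contextual [mul_pow]
  have h3 : (Finset.univ.filter (fun x : G => x ^ d = 1)).card = d := by
    have := IsCyclic.card_powMonoidHom_ker G d
    rw [hc, Nat.gcd_mul_left_left] at this
    refine Eq.trans ?_ this
    rw [Nat.card_eq_fintype_card, Fintype.card_subtype]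
    congr 1
    ext x
    simp [MonoidHom.mem_ker]
  have h4 : ({x ∈ Finset.univ.filter P | x ^ d = a ^ d} : Finset G).card = d := by
    refine Eq.trans ?_ (h2.trans h3)
    rw [h1]; congr 1
  rw [h4]

lemma trace_frob {p : ℕ} [Fact p.Prime] {F : Type*} [Field F] [Finite F] [Algebra (ZMod p) F]
    [CharP F p] (k : ℕ) (x : F) :
    Algebra.trace (ZMod p) F (x ^ p ^ k) = Algebra.trace (ZMod p) F x := by
  induction k generalizing x with
  | zero => simp
  | succ k ih =>
    rw [pow_succ, pow_mul, ← ih x]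
    have := Algebra.trace_eq_of_algEquiv (FiniteField.frobeniusAlgEquiv (ZMod p) F p) (x ^ p ^ k)
    simpa [ZMod.card] using this

open Classical in
/-- squared Gauss sum -/
lemma sum_sq {p : ℕ} [Fact p.Prime] (hp2 : p ≠ 2) {F : Type*} [Field F] [Fintype F]
    [Algebra (ZMod p) F] [CharP F p] (l : ℕ) (ψ : AddChar (ZMod p) ℂ) (hψ : ψ ≠ 1) :
    (∑ x : F, ψ (Algebra.trace (ZMod p) F (x ^ (p ^ l + 1)))) *
      (∑ x : F, ψ (-Algebra.trace (ZMod p) F (x ^ (p ^ l + 1)))) =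
    (Fintype.card F : ℂ) * (Finset.univ.filter (fun y : F => y ^ p ^ (2 * l) + y = 0)).card := by
  set T := Algebra.trace (ZMod p) F with hT
  let χ : AddChar F ℂ := ψ.compAddMonoidHom T.toAddMonoidHom
  have hχa : ∀ x, χ x = ψ (T x) := fun x => rfl
  have hχ : χ ≠ 1 := by
    obtain ⟨c, hc⟩ := AddChar.ne_one_iff.mp hψ
    obtain ⟨x, hx⟩ := Algebra.trace_surjective (ZMod p) F c
    refine AddChar.ne_one_iff.mpr ⟨x, ?_⟩
    rw [hχa, hT, hx]; exact hc
  have hprim := AddChar.IsPrimitive.of_ne_one hχ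
  have key : ∀ x y : F, T ((x + y) ^ (p ^ l + 1)) - T (x ^ (p ^ l + 1)) =
      T (y ^ (p ^ l + 1)) + T (x ^ p ^ l * (y ^ p ^ (2 * l) + y)) := by
    intro x y
    have h1 : T (y ^ p ^ l * x) = T (x ^ p ^ l * y ^ p ^ (2 * l)) := by
      rw [hT, ← trace_frob l (y ^ p ^ l * x), mul_pow, ← pow_mul, ← pow_add, ← two_mul, mul_comm]
    have h2 : (x + y) ^ (p ^ l + 1) = x ^ (p ^ l + 1) + (x ^ p ^ l * y + y ^ p ^ l * x)
        + y ^ (p ^ l + 1) := by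
      rw [pow_succ, add_pow_char_pow]; ring
    rw [h2, mul_add]
    simp only [map_add, h1]; ring
  have hrad : ∀ y : F, y ^ p ^ (2 * l) + y = 0 → T (y ^ (p ^ l + 1)) = 0 := by
    intro y hy
    have h0 := key (-y) y
    rw [hy] at h0
    have he : Even (p ^ l + 1) :=
      ((Nat.Prime.odd_of_ne_two (Fact.out : p.Prime) hp2).pow).add_one
    rw [he.neg_pow] at h0
    simp at h0
    have h2 : (2 : ZMod p) ≠ 0 := by
      intro h
      have h' : ((2 : ℕ) : ZMod p) = 0 := by exact_mod_cast h
      rw [ZMod.natCast_eq_zero_iff] at h'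
      exact hp2 ((Nat.prime_dvd_prime_iff_eq Fact.out Nat.prime_two).mp h')
    have : (2 : ZMod p) * T (y ^ (p ^ l + 1)) = 0 := by linear_combination -h0
    exact (mul_eq_zero.mp this).resolve_left h2
  calc _ = ∑ x : F, ∑ y : F, ψ (T (y ^ (p ^ l + 1))) * ψ (-T (x ^ (p ^ l + 1))) := by
        rw [Finset.sum_mul_sum, Finset.sum_comm]
    _ = ∑ x : F, ∑ y : F, ψ (T ((x + y) ^ (p ^ l + 1))) * ψ (-T (x ^ (p ^ l + 1))) := by
        refine Finset.sum_congr rfl fun x _ => ?_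
        exact (Equiv.sum_comp (Equiv.addLeft x)
          (fun y => ψ (T (y ^ (p ^ l + 1))) * ψ (-T (x ^ (p ^ l + 1))))).symm
    _ = ∑ y : F, ψ (T (y ^ (p ^ l + 1))) * ∑ x : F, χ (x ^ p ^ l * (y ^ p ^ (2 * l) + y)) := by
        rw [Finset.sum_comm]
        refine Finset.sum_congr rfl fun y _ => ?_
        rw [Finset.mul_sum]
        refine Finset.sum_congr rfl fun x _ => ?_
        rw [← AddChar.map_add_eq_mul, ← sub_eq_add_neg, key, AddChar.map_add_eq_mul, hχa]
    _ = ∑ y : F, ψ (T (y ^ (p ^ l + 1))) * ∑ x : F, χ (x * (y ^ p ^ (2 * l) + y)) := by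
        refine Finset.sum_congr rfl fun y _ => ?_
        congr 1
        refine Function.Bijective.sum_comp (e := fun x : F => x ^ p ^ l) ?_
          (fun x => χ (x * (y ^ p ^ (2 * l) + y)))
        exact Finite.injective_iff_bijective.mp (iterateFrobenius_inj F p l)
    _ = ∑ y : F, if y ^ p ^ (2 * l) + y = 0 then (Fintype.card F : ℂ) else 0 := by
        refine Finset.sum_congr rfl fun y _ => ?_
        rw [AddChar.sum_mulShift _ hprim]
        split_ifs with h
        · rw [hrad y h]; simp
        · simp
    _ = _ := by
        rw [← Finset.sum_filter, Finset.sum_const, nsmul_eq_mul, mul_comm]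


lemma neg_iter {p : ℕ} [Fact p.Prime] (hp2 : p ≠ 2) {F : Type*} [Field F] (a : ℕ) (y : F)
    (hy : y ^ p ^ a = -y) (k : ℕ) : y ^ p ^ (a * k) = (-1) ^ k * y := by
  have ho : Odd p := Nat.Prime.odd_of_ne_two (Fact.out : p.Prime) hp2
  induction k with
  | zero => simp
  | succ k ih =>
    rw [mul_add, mul_one, pow_add, pow_mul, ih, mul_pow, hy, ← pow_mul, mul_comm k, pow_mul,
      (ho.pow).neg_one_pow, pow_succ]
    ring

lemma rad_odd {p : ℕ} [Fact p.Prime] (hp2 : p ≠ 2) {F : Type*} [Field F] [Fintype F] [CharP F p]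
    (s u v : ℕ) (hu : Odd u) (hq : Fintype.card F = p ^ (2 * (s * u))) (y : F) :
    y ^ p ^ (2 * (s * v)) + y = 0 ↔ y = 0 := by
  have ho : Odd p := Nat.Prime.odd_of_ne_two (Fact.out : p.Prime) hp2
  constructor
  · intro h
    have h1 := neg_iter hp2 _ y (eq_neg_of_add_eq_zero_left h) u
    have h2 : y ^ p ^ (2 * (s * v) * u) = y := by
      have : 2 * (s * v) * u = 2 * (s * u) * v := by ring
      rw [this, pow_mul, ← hq]
      exact FiniteField.pow_card_pow v y
    rw [h2, hu.neg_one_pow] at h1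
    have h3 : (2 : F) * y = 0 := by linear_combination h1
    refine (mul_eq_zero.mp h3).resolve_left ?_
    exact Ring.two_ne_zero (by rw [ringChar.eq F p]; exact hp2)
  · rintro rfl
    have := (Fact.out : p.Prime).pos
    simp [this.ne']

open Classical in
lemma card_fixed {p : ℕ} [Fact p.Prime] {F : Type*} [Field F] [Fintype F]
    (a b : ℕ) (ha : 0 < a) (hq : Fintype.card F = p ^ b) :
    (Finset.univ.filter (fun z : F => z ^ p ^ a = z)).card = p ^ (Nat.gcd a b) := by
  have hpp := (Fact.out : p.Prime)
  have hpa : 1 < p ^ a := Nat.one_lt_pow ha.ne' hpp.one_lt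
  have h1 : (Finset.univ.filter (fun z : F => z ^ p ^ a = z)) =
      insert 0 ((Finset.univ.filter (fun z : Fˣ => z ^ (p ^ a - 1) = 1)).map
        ⟨Units.val, Units.val_injective⟩) := by
    ext z
    simp only [Finset.mem_filter, Finset.mem_univ, true_and, Finset.mem_insert, Finset.mem_map,
      Function.Embedding.coeFn_mk]
    constructor
    · intro h
      by_cases hz : z = 0
      · exact Or.inl hz
      · right
        refine ⟨Units.mk0 z hz, ?_, rfl⟩
        ext
        simp only [Units.val_pow_eq_pow_val, Units.val_mk0, Units.val_one]
        have : z * z ^ (p ^ a - 1) = z * 1 := by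
          rw [← pow_succ', Nat.sub_add_cancel hpa.le, h, mul_one]
        exact mul_left_cancel₀ hz this
    · rintro (rfl | ⟨w, hw, rfl⟩)
      · simp [hpp.ne_zero]
      · have h2 : ((w ^ (p ^ a - 1) : Fˣ) : F) = 1 := by rw [hw]; rfl
        rw [Units.val_pow_eq_pow_val] at h2
        calc (w : F) ^ p ^ a = (w : F) ^ (p ^ a - 1 + 1) := by rw [Nat.sub_add_cancel hpa.le]
          _ = w := by rw [pow_succ, h2, one_mul]
  rw [h1, Finset.card_insert_of_notMem (by simp), Finset.card_map]
  have := IsCyclic.card_powMonoidHom_ker Fˣ (p ^ a - 1)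
  rw [Nat.card_units, Nat.card_eq_fintype_card (α := F), hq,
    Nat.pow_sub_one_gcd_pow_sub_one, Nat.gcd_comm] at this
  have h3 : (Finset.univ.filter (fun z : Fˣ => z ^ (p ^ a - 1) = 1)).card
      = p ^ (Nat.gcd a b) - 1 := by
    refine Eq.trans ?_ this
    rw [Nat.card_eq_fintype_card, Fintype.card_subtype]
    congr 1
    ext x
    simp [MonoidHom.mem_ker]
  rw [h3, Nat.sub_add_cancel (Nat.one_le_pow _ _ hpp.pos)]

open Classical in
lemma rad_even {p : ℕ} [Fact p.Prime] (hp2 : p ≠ 2) {F : Type*} [Field F] [Fintype F]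
    (s u v : ℕ) (hs : 0 < s) (hu : Even u) (hv : Odd v) (huv : Nat.Coprime v u)
    (hq : Fintype.card F = p ^ (2 * (s * u))) :
    (Finset.univ.filter (fun y : F => y ^ p ^ (2 * (s * v)) + y = 0)).card = p ^ (2 * s) := by
  have hpp := (Fact.out : p.Prime)
  have ho : Odd p := Nat.Prime.odd_of_ne_two hpp hp2
  obtain ⟨w, rfl⟩ := hu
  obtain ⟨k, hk⟩ : p ^ (2 * s) - 1 ∣ p ^ (2 * (s * w)) - 1 := by
    rw [← mul_assoc, pow_mul p (2 * s) w]
    exact Nat.sub_one_dvd_pow_sub_one _ _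
  have hcard : Nat.card Fˣ = (k * (p ^ (2 * (s * w)) + 1)) * (p ^ (2 * s) - 1) := by
    rw [Nat.card_units, Nat.card_eq_fintype_card, hq]
    have : p ^ (2 * (s * (w + w))) - 1 = (p ^ (2 * (s * w)) + 1) * (p ^ (2 * (s * w)) - 1) := by
      rw [← Nat.sq_sub_sq, one_pow, ← pow_mul]
      congr 2; ring
    rw [this, hk]; ring
  obtain ⟨y0, hy0⟩ := exists_root _ _ hcard (-1 : Fˣ)
    (Even.neg_one_pow ((ho.pow.add_one).mul_left _))
  have hps : 1 ≤ p ^ (2 * s) := Nat.one_le_pow _ _ hpp.pos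
  have hy1 : (y0 : F) ^ p ^ (2 * s) = -y0 := by
    have h2 : ((y0 ^ (p ^ (2 * s) - 1) : Fˣ) : F) = -1 := by rw [hy0]; simp
    rw [Units.val_pow_eq_pow_val] at h2
    calc (y0 : F) ^ p ^ (2 * s) = (y0 : F) ^ (p ^ (2 * s) - 1 + 1) := by
          rw [Nat.sub_add_cancel hps]
      _ = -y0 := by rw [pow_succ, h2]; ring
  have hy2 : (y0 : F) ^ p ^ (2 * (s * v)) = -y0 := by
    rw [← mul_assoc, neg_iter hp2 _ _ hy1, hv.neg_one_pow]; ring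
  have hg : Nat.gcd (2 * (s * v)) (2 * (s * (w + w))) = 2 * s := by
    rw [← mul_assoc, ← mul_assoc, Nat.gcd_mul_left, huv.gcd_eq_one, mul_one]
  rw [← hg, ← card_fixed (F := F) _ _ (by have := hv.pos; positivity) hq]
  symm
  have hne : (y0 : F) ≠ 0 := y0.ne_zero
  refine Finset.card_bij' (fun z _ => z * y0) (fun y _ => y * (y0 : F)⁻¹) ?_ ?_ ?_ ?_
  · intro z hz
    simp only [Finset.mem_filter, Finset.mem_univ, true_and] at hz ⊢
    rw [mul_pow, hy2, hz]; ring
  · intro y hy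
    simp only [Finset.mem_filter, Finset.mem_univ, true_and] at hy ⊢
    rw [mul_pow, inv_pow, hy2, eq_neg_of_add_eq_zero_left hy]
    field_simp
  · intro z _; field_simp
  · intro z _; field_simp

open Classical in
lemma char_sum {p : ℕ} [Fact p.Prime] {F : Type*} [Fintype F] (Q : F → ZMod p)
    (hN : ∀ c : ZMod p, c ≠ 0 → (Finset.univ.filter (fun x => Q x = c)).card =
      (Finset.univ.filter (fun x => Q x = 1)).card)
    (ψ : AddChar (ZMod p) ℂ) (hψ : ψ ≠ 1) :
    ∑ x, ψ (Q x) = ((Finset.univ.filter (fun x => Q x = 0)).card : ℂ) -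
      (Finset.univ.filter (fun x => Q x = 1)).card := by
  have h0 := AddChar.sum_eq_zero_of_ne_one hψ
  rw [← Finset.sum_fiberwise (s := Finset.univ) (g := Q)]
  have h1 : ∀ c : ZMod p, ∑ x ∈ Finset.univ.filter (fun x => Q x = c), ψ (Q x) =
      ((Finset.univ.filter (fun x => Q x = c)).card : ℂ) * ψ c := by
    intro c
    rw [Finset.sum_congr rfl (g := fun _ => ψ c), Finset.sum_const, nsmul_eq_mul]
    intro x hx
    rw [(Finset.mem_filter.mp hx).2]
  rw [Finset.sum_congr rfl (fun c _ => h1 c)]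
  rw [← Finset.add_sum_erase _ _ (Finset.mem_univ (0 : ZMod p))] at h0 ⊢
  rw [Finset.sum_congr rfl (g := fun c => ((Finset.univ.filter (fun x => Q x = 1)).card : ℂ) * ψ c),
    ← Finset.mul_sum]
  · simp only [AddChar.map_zero_eq_one] at h0 ⊢
    rw [eq_neg_of_add_eq_zero_right h0]; ring
  · intro c hc
    rw [hN c (Finset.ne_of_mem_erase hc)]

open Classical in
lemma card_one {p : ℕ} [Fact p.Prime] (hp2 : p ≠ 2) {F : Type*} [Field F] [Fintype F]
    [Algebra (ZMod p) F] [CharP F p] (s u v M : ℕ) (hs : 0 < s) (hv : Odd v) (hu : 0 < u)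
    (hM0 : 0 < M)
    (hq : Fintype.card F = p ^ (2 * (s * u)))
    (hR : (Fintype.card F) *
      (Finset.univ.filter (fun y : F => y ^ p ^ (2 * (s * v)) + y = 0)).card = (p ^ M) ^ 2)
    (hM : p ^ s + 1 ∣ p ^ M + 1) :
    (Finset.univ.filter
      (fun x : F => Algebra.trace (ZMod p) F (x ^ (p ^ (s * v) + 1)) = 1)).card
      = p ^ (2 * (s * u) - 1) + p ^ (M - 1) := by
  have hpp := (Fact.out : p.Prime)
  have ho : Odd p := Nat.Prime.odd_of_ne_two hpp hp2
  set Q : F → ZMod p := fun x => Algebra.trace (ZMod p) F (x ^ (p ^ (s * v) + 1)) with hQ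
  -- factorisation of q - 1
  obtain ⟨k0, hk0⟩ : p ^ (2 * s) - 1 ∣ p ^ (2 * (s * u)) - 1 := by
    rw [← mul_assoc, pow_mul p (2 * s) u]
    exact Nat.sub_one_dvd_pow_sub_one _ _
  have hfac : p ^ (2 * s) - 1 = (p ^ s + 1) * (p ^ s - 1) := by
    rw [← Nat.sq_sub_sq, one_pow, ← pow_mul, mul_comm s 2]
  have hcard : Nat.card Fˣ = (k0 * (p ^ s - 1)) * (p ^ s + 1) := by
    rw [Nat.card_units, Nat.card_eq_fintype_card, hq, hk0, hfac]; ring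
  obtain ⟨k1, hk1⟩ : p - 1 ∣ p ^ s - 1 := Nat.sub_one_dvd_pow_sub_one _ _
  obtain ⟨nn, hnn⟩ : p ^ s + 1 ∣ p ^ (s * v) + 1 := by
    have := Odd.nat_add_dvd_pow_add_pow (p ^ s) 1 hv
    rwa [one_pow, ← pow_mul] at this
  -- scaling
  have hscale : ∀ c : ZMod p, c ≠ 0 → ∃ t : F, t ≠ 0 ∧
      t ^ (p ^ (s * v) + 1) = algebraMap (ZMod p) F c := by
    intro c hc
    have hc' : algebraMap (ZMod p) F c ≠ 0 := by simpa using hc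
    have hcp : (Units.mk0 _ hc') ^ (p ^ s - 1) = 1 := by
      ext
      rw [Units.val_pow_eq_pow_val, Units.val_mk0, ← map_pow, hk1, pow_mul,
        ZMod.pow_card_sub_one_eq_one hc]
      simp
    obtain ⟨t, ht⟩ := exists_root _ _ hcard (Units.mk0 _ hc') (by
      rw [mul_comm, pow_mul, hcp, one_pow])
    refine ⟨t, t.ne_zero, ?_⟩
    have ht1 : t ^ (p ^ (2 * s) - 1) = 1 := by
      rw [hfac, pow_mul, ht, hcp]
    have ht2 : t ^ p ^ (2 * s) = t := by
      calc t ^ p ^ (2 * s) = t ^ (p ^ (2 * s) - 1 + 1) := by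
            rw [Nat.sub_add_cancel (Nat.one_le_pow _ _ hpp.pos)]
        _ = t := by rw [pow_succ, ht1, one_mul]
    have ht3 : ∀ k, t ^ p ^ (2 * s * k) = t := by
      intro k
      induction k with
      | zero => simp
      | succ k ih => rw [mul_add, mul_one, pow_add, pow_mul, ih, ht2]
    obtain ⟨j, rfl⟩ := hv
    have ht4 : t ^ p ^ (s * (2 * j + 1)) = t ^ p ^ s := by
      have : s * (2 * j + 1) = 2 * s * j + s := by ring
      rw [this, pow_add, pow_mul, ht3]
    have ht5 : t ^ (p ^ (s * (2 * j + 1)) + 1) = Units.mk0 _ hc' := by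
      rw [pow_succ, ht4, ← pow_succ, ht]
    have := congrArg Units.val ht5
    simpa using this
  have hN : ∀ c : ZMod p, c ≠ 0 → (Finset.univ.filter (fun x => Q x = c)).card =
      (Finset.univ.filter (fun x => Q x = 1)).card := by
    intro c hc
    obtain ⟨t, ht0, ht⟩ := hscale c hc
    have hQt : ∀ x, Q (t * x) = c * Q x := by
      intro x
      simp only [hQ]
      rw [mul_pow, ht, ← Algebra.smul_def, map_smul, smul_eq_mul]
    symm
    refine Finset.card_bij' (fun x _ => t * x) (fun x _ => t⁻¹ * x) ?_ ?_ ?_ ?_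
    · intro x hx
      simp only [Finset.mem_filter, Finset.mem_univ, true_and] at hx ⊢
      rw [hQt, hx, mul_one]
    · intro x hx
      simp only [Finset.mem_filter, Finset.mem_univ, true_and] at hx ⊢
      have := hQt (t⁻¹ * x)
      rw [mul_inv_cancel_left₀ ht0, hx] at this
      exact mul_left_cancel₀ hc (by rw [← this, mul_one])
    · intro x _; field_simp
    · intro x _; field_simp
  set N0 := (Finset.univ.filter (fun x => Q x = 0)).card with hN0
  set N1 := (Finset.univ.filter (fun x => Q x = 1)).card with hN1
  -- total
  have htot : N0 + (p - 1) * N1 = p ^ (2 * (s * u)) := by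
    rw [← hq, ← Finset.card_univ,
      Finset.card_eq_sum_card_fiberwise (f := Q) (t := Finset.univ) (by simp),
      ← Finset.add_sum_erase _ _ (Finset.mem_univ (0 : ZMod p)),
      Finset.sum_congr rfl (fun c hc => hN c (Finset.ne_of_mem_erase hc))]
    rw [Finset.sum_const, Finset.card_erase_of_mem (Finset.mem_univ _), Finset.card_univ,
      ZMod.card, smul_eq_mul]
  -- square
  have hsq : ((N0 : ℤ) - N1) ^ 2 = ((p : ℤ) ^ M) ^ 2 := by
    have hψ : (ZMod.stdAddChar (N := p)) ≠ 1 := by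
      intro h
      have h2 := ZMod.isPrimitive_stdAddChar p (one_ne_zero)
      apply h2
      rw [AddChar.mulShift_one, h]
    have h1 := sum_sq hp2 (F := F) (s * v) _ hψ
    have h2 := char_sum Q hN _ hψ
    have h3 := char_sum Q hN (ZMod.stdAddChar (N := p))⁻¹ (inv_ne_one.mpr hψ)
    simp only [AddChar.inv_apply] at h3
    rw [h2, h3] at h1
    have h4 : (((N0 : ℤ) - N1) ^ 2 : ℂ) = ((p : ℂ) ^ M) ^ 2 := by
      rw [← Nat.cast_mul, hR] at h1
      rw [sq]
      push_cast at h1 ⊢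
      exact h1
    exact_mod_cast h4
  -- divisibility
  have hdvd : ∀ c : ZMod p, p ^ s + 1 ∣
      (Finset.univ.filter (fun x : Fˣ => Q (x : F) = c)).card := by
    intro c
    refine dvd_card_fib _ _ hcard _ ?_
    intro a b hab ha
    have : (a : F) ^ (p ^ (s * v) + 1) = (b : F) ^ (p ^ (s * v) + 1) := by
      have := congrArg Units.val hab
      simp only [Units.val_pow_eq_pow_val] at this
      rw [hnn, pow_mul, pow_mul, this]
    simp only [hQ] at ha ⊢
    rw [← this]; exact ha
  have hQ0 : Q 0 = 0 := by simp [hQ]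
  have hd1 : p ^ s + 1 ∣ N1 := by
    have h := hdvd 1
    rw [← Finset.card_map ⟨Units.val, Units.val_injective⟩] at h
    convert h using 2
    ext x
    simp only [Finset.mem_filter, Finset.mem_univ, true_and, Finset.mem_map,
      Function.Embedding.coeFn_mk]
    constructor
    · intro hx
      have hx0 : x ≠ 0 := by rintro rfl; rw [hQ0] at hx; exact zero_ne_one hx
      exact ⟨Units.mk0 x hx0, hx, rfl⟩
    · rintro ⟨w, hw, rfl⟩; exact hw
  obtain ⟨j0, hj0⟩ : ∃ j, N0 = 1 + (p ^ s + 1) * j := by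
    obtain ⟨j, hj⟩ := hdvd 0
    refine ⟨j, ?_⟩
    rw [← hj, add_comm, ← Finset.card_map ⟨Units.val, Units.val_injective⟩,
      ← Finset.card_insert_of_notMem (a := (0 : F)) (by simp)]
    rw [hN0]
    congr 1
    ext x
    simp only [Finset.mem_filter, Finset.mem_univ, true_and, Finset.mem_map,
      Function.Embedding.coeFn_mk, Finset.mem_insert]
    constructor
    · intro hx
      by_cases hx0 : x = 0
      · exact Or.inl hx0
      · exact Or.inr ⟨Units.mk0 x hx0, hx, rfl⟩
    · rintro (rfl | ⟨w, hw, rfl⟩)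
      · exact hQ0
      · exact hw
  obtain ⟨j1, hj1⟩ := hd1
  obtain ⟨j2, hj2⟩ := hM
  have hp3 : 2 < p := lt_of_le_of_ne hpp.two_le (Ne.symm hp2)
  have hps : p ≤ p ^ s := Nat.le_self_pow hs.ne' p
  have hD : (N0 : ℤ) - N1 = -(p : ℤ) ^ M := by
    rcases sq_eq_sq_iff_eq_or_eq_neg.mp hsq with h | h
    · exfalso
      have e0 : (N0 : ℤ) = 1 + ((p : ℤ) ^ s + 1) * j0 := by exact_mod_cast hj0
      have e1 : (N1 : ℤ) = ((p : ℤ) ^ s + 1) * j1 := by exact_mod_cast hj1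
      have e2 : (p : ℤ) ^ M + 1 = ((p : ℤ) ^ s + 1) * j2 := by exact_mod_cast hj2
      have : ((p : ℤ) ^ s + 1) ∣ 2 := ⟨j2 - j0 + j1, by linear_combination h - e0 + e1 + e2⟩
      have h5 := Int.le_of_dvd (by norm_num) this
      have : (p : ℤ) ≤ (p : ℤ) ^ s := by exact_mod_cast hps
      have : (2 : ℤ) < p := by exact_mod_cast hp3
      omega
    · exact h
  have hsu : 0 < s * u := Nat.mul_pos hs hu
  have h6 : (p : ℤ) * N1 = (p : ℤ) * ((p : ℤ) ^ (2 * (s * u) - 1) + (p : ℤ) ^ (M - 1)) := by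
    rw [mul_add, ← pow_succ', ← pow_succ', Nat.sub_add_cancel (by omega),
      Nat.sub_add_cancel (by omega)]
    have : (N0 : ℤ) + (p - 1) * N1 = (p : ℤ) ^ (2 * (s * u)) := by
      rw [← Nat.cast_one, ← Nat.cast_sub hpp.one_le]; exact_mod_cast htot
    linear_combination this - hD
  have h7 := mul_left_cancel₀ (by exact_mod_cast hpp.ne_zero) h6
  exact_mod_cast h7


open Classical in
lemma card_cyc (p : ℕ) [Fact p.Prime] (hp : p % 4 = 3) (i : ℕ) :
    2 * (cyc p i).card = p - 1 := by
  have hns : ¬ IsSquare (-1 : ZMod p) := by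
    rw [ZMod.exists_sq_eq_neg_one_iff]; simpa using hp
  have h1 : (cyc p 0).card = (cyc p 1).card := by
    have hneg : ∀ x : ZMod p, x ≠ 0 → (IsSquare (-x) ↔ ¬ IsSquare x) := by
      intro x hx
      have hp2 : ringChar (ZMod p) ≠ 2 := by
        rw [ZMod.ringChar_zmod_n]; rintro rfl; omega
      rw [← quadraticChar_one_iff_isSquare (neg_ne_zero.mpr hx),
        ← quadraticChar_neg_one_iff_not_isSquare (F := ZMod p)]
      have h3 : quadraticChar (ZMod p) (-1) = -1 :=
        quadraticChar_neg_one_iff_not_isSquare.mpr hns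
      rw [← neg_one_mul x, map_mul, h3]
      constructor <;> intro h <;> linarith
    refine Finset.card_bij' (fun x _ => -x) (fun x _ => -x) ?_ ?_ ?_ ?_
    · intro x hx
      simp only [cyc, Finset.mem_filter, Finset.mem_univ, true_and, if_true, one_ne_zero,
        if_false] at hx ⊢
      refine ⟨neg_ne_zero.mpr hx.1, ?_⟩
      rw [hneg x hx.1]; simpa using hx.2
    · intro x hx
      simp only [cyc, Finset.mem_filter, Finset.mem_univ, true_and, if_true, one_ne_zero,
        if_false] at hx ⊢
      exact ⟨neg_ne_zero.mpr hx.1, (hneg x hx.1).mpr hx.2⟩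
    · simp
    · simp
  have h2 : (cyc p 0).card + (cyc p 1).card = p - 1 := by
    have h3 : (Finset.univ.erase (0 : ZMod p)).card = p - 1 := by
      rw [Finset.card_erase_of_mem (Finset.mem_univ _), Finset.card_univ, ZMod.card]
    rw [← h3, ← Finset.card_filter_add_card_filter_not (s := Finset.univ.erase (0 : ZMod p))
      (fun x => IsSquare x)]
    congr 2 <;> ext x <;> simp [cyc]
  have h4 : (cyc p i).card = (cyc p 0).card := by
    by_cases hi : i = 0
    · rw [hi]
    · rw [h1]; congr 1; ext x; simp [cyc, hi]
  omega

open Classical in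
lemma card_trace_mem {p : ℕ} [Fact p.Prime] {F : Type*} [Field F] [Fintype F]
    [Algebra (ZMod p) F] (A : Finset (ZMod p)) :
    p * (Finset.univ.filter (fun x : F => Algebra.trace (ZMod p) F x ∈ A)).card =
      A.card * Fintype.card F := by
  set T := Algebra.trace (ZMod p) F
  have h1 : ∀ c, (Finset.univ.filter (fun x : F => T x = c)).card =
      (Finset.univ.filter (fun x : F => T x = 0)).card := by
    intro c
    obtain ⟨y, hy⟩ := Algebra.trace_surjective (ZMod p) F c
    refine Finset.card_bij' (fun x _ => x - y) (fun x _ => x + y) ?_ ?_ ?_ ?_ <;>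
      simp +contextual [T, hy]
  have h2 : ∀ B : Finset (ZMod p), (Finset.univ.filter (fun x : F => T x ∈ B)).card =
      B.card * (Finset.univ.filter (fun x : F => T x = 0)).card := by
    intro B
    rw [Finset.card_eq_sum_card_fiberwise (f := T) (t := B) (by intro x hx; simpa using hx)]
    rw [← smul_eq_mul, ← Finset.sum_const]
    refine Finset.sum_congr rfl fun c hc => ?_
    rw [← h1 c]
    congr 1
    ext x
    simp only [Finset.mem_filter, Finset.mem_univ, true_and]
    exact ⟨fun h => h.2, fun h => ⟨h ▸ hc, h⟩⟩
  have h3 := h2 Finset.univ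
  rw [Finset.card_univ, ZMod.card] at h3
  simp only [Finset.mem_univ, Finset.filter_true, Finset.card_univ] at h3
  rw [h2 A, h3]; ring

open Classical in
lemma final (p e l M : ℕ) [Fact p.Prime] [Fintype (GaloisField p e)] (hp : p % 4 = 3)
    (he : 2 ≤ e) (hM : 0 < M) (i : ℕ)
    (h : (Finset.univ.filter (fun x : GaloisField p e =>
      Algebra.trace (ZMod p) (GaloisField p e) (x ^ (p ^ l + 1)) = 1)).card
        = p ^ (e - 1) + p ^ (M - 1)) :
    (Nat.card {x : GaloisField p e × GaloisField p e //
            tr p e (x.1 ^ (p ^ l + 1)) = 1 ∧ tr p e x.2 ∈ cyc p i} : ℚ) =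
          ((p : ℚ) - 1) / 2 * ((p : ℚ) ^ (2 * e - 2) + (p : ℚ) ^ (e + M - 2)) := by
  have hpp := (Fact.out : p.Prime)
  have h1 : Nat.card {x : GaloisField p e × GaloisField p e //
            tr p e (x.1 ^ (p ^ l + 1)) = 1 ∧ tr p e x.2 ∈ cyc p i} =
      (Finset.univ.filter (fun x : GaloisField p e =>
      Algebra.trace (ZMod p) (GaloisField p e) (x ^ (p ^ l + 1)) = 1)).card *
      (Finset.univ.filter (fun x : GaloisField p e =>
        Algebra.trace (ZMod p) (GaloisField p e) x ∈ cyc p i)).card := by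
    rw [← Finset.card_product, Nat.card_eq_fintype_card]
    exact Fintype.card_of_subtype _ (fun x => by simp [tr])
  have h2 := card_trace_mem (p := p) (F := GaloisField p e) (cyc p i)
  have hq : Fintype.card (GaloisField p e) = p ^ e := by
    rw [← Nat.card_eq_fintype_card]; exact GaloisField.card p e (by omega)
  have h3 := card_cyc p hp i
  rw [h1, h]
  set K := (Finset.univ.filter (fun x : GaloisField p e =>
        Algebra.trace (ZMod p) (GaloisField p e) x ∈ cyc p i)).card
  have hp0 : (p : ℚ) ≠ 0 := by exact_mod_cast hpp.ne_zero
  have h4 : (2 : ℚ) * (cyc p i).card = p - 1 := by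
    rw [← Nat.cast_one (R := ℚ), ← Nat.cast_sub hpp.one_le]; exact_mod_cast h3
  have h5 : (p : ℚ) * K = (cyc p i).card * (p : ℚ) ^ e := by
    rw [hq] at h2; exact_mod_cast h2
  have h6 : (K : ℚ) = (p - 1) / 2 * (p : ℚ) ^ (e - 1) := by
    apply mul_left_cancel₀ hp0
    rw [h5, ← h4]
    obtain ⟨e', rfl⟩ : ∃ e', e = e' + 1 := ⟨e - 1, by omega⟩
    rw [Nat.add_sub_cancel, pow_succ]; ring
  push_cast
  rw [h6]
  have e1 : 2 * e - 2 = (e - 1) + (e - 1) := by omega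
  have e2 : e + M - 2 = (e - 1) + (M - 1) := by omega
  rw [e1, e2, pow_add, pow_add]
  ring

end LenAux

/-- the length `n_i = |D_i|` of the code `C_{D_i}` (paper Lemma 8). -/
theorem length_eval (p e l m s : ℕ) [Fact p.Prime] (hp : p % 4 = 3)
    (hl : 0 < l) (hm : 1 ≤ m) (he : e = 2 * m) (hs : s = Nat.gcd l e) (hsm : s ∣ m) :
    ∀ i ≤ 1,
      (Odd (m / s) →
        (Nat.card {x : GaloisField p e × GaloisField p e //
            tr p e (x.1 ^ (p ^ l + 1)) = 1 ∧ tr p e x.2 ∈ cyc p i} : ℚ) =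
          ((p : ℚ) - 1) / 2 * ((p : ℚ) ^ (2 * e - 2) + (p : ℚ) ^ (e + m - 2))) ∧
      (Even (m / s) →
        (Nat.card {x : GaloisField p e × GaloisField p e //
            tr p e (x.1 ^ (p ^ l + 1)) = 1 ∧ tr p e x.2 ∈ cyc p i} : ℚ) =
          ((p : ℚ) - 1) / 2 * ((p : ℚ) ^ (2 * e - 2) + (p : ℚ) ^ (e + m + s - 2))) := by
  classical
  intro i _
  have hpp := (Fact.out : p.Prime)
  have hp2 : p ≠ 2 := by rintro rfl; omega
  haveI : Fintype (GaloisField p e) := Fintype.ofFinite _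
  have hs0 : 0 < s := by rw [hs]; exact Nat.gcd_pos_of_pos_left _ hl
  obtain ⟨u, rfl⟩ := hsm
  have hu : 0 < u := Nat.pos_of_mul_pos_left hm
  obtain ⟨v, rfl⟩ : s ∣ l := by rw [hs]; exact Nat.gcd_dvd_left _ _
  have hq : Fintype.card (GaloisField p e) = p ^ (2 * (s * u)) := by
    rw [← Nat.card_eq_fintype_card, ← he]; exact GaloisField.card p e (by omega)
  have hco : Nat.Coprime v (2 * u) := by
    rw [he, mul_left_comm 2 s u, Nat.gcd_mul_left] at hs
    exact Nat.eq_of_mul_eq_mul_left hs0 (by rw [← hs, mul_one])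
  have hv : Odd v := by
    have : Nat.Coprime v 2 := hco.coprime_mul_right_right
    exact Nat.coprime_two_right.mp this
  have hvu : Nat.Coprime v u := hco.coprime_mul_left_right
  rw [Nat.mul_div_cancel_left u hs0]
  constructor
  · intro ho
    refine LenAux.final p e (s * v) (s * u) hp (by omega) (by omega) i ?_
    rw [LenAux.card_one hp2 s u v (s * u) hs0 hv hu (by omega) hq]
    · rw [he]
    · have : (Finset.univ.filter (fun y : GaloisField p e =>
          y ^ p ^ (2 * (s * v)) + y = 0)) = {0} := by
        ext y
        simp only [Finset.mem_filter, Finset.mem_univ, true_and, Finset.mem_singleton]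
        exact LenAux.rad_odd hp2 s u v ho hq y
      rw [this, Finset.card_singleton, hq, mul_one, ← pow_mul]
      congr 1; ring
    · have := Odd.nat_add_dvd_pow_add_pow (p ^ s) 1 ho
      rwa [one_pow, ← pow_mul] at this
  · intro hev
    have := LenAux.final p e (s * v) (s * u + s) hp (by omega) (by omega) i ?_
    · rw [← add_assoc] at this; exact this
    rw [LenAux.card_one hp2 s u v (s * u + s) hs0 hv hu (by omega) hq]
    · rw [he]
    · rw [LenAux.rad_even hp2 s u v hs0 hev hv hvu hq, hq, ← pow_add, ← pow_mul]
      congr 1; ring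
    · have := Odd.nat_add_dvd_pow_add_pow (p ^ s) 1 hev.add_one
      rwa [one_pow, ← pow_mul] at this

end
end

section
/- Let e = 2m with m ≥ 1, suppose s divides m and m/s ≡ 1 (mod 2), and let a ∈ F_q with a ≠ 0. Then the equation X^{p^{2l}} + X = -a^{p^l} has a unique solution γ in F_q, and ψ_3(a) = -((p-1)/2) p^{e+m-3} - ((p-1)/2) p^{e+m-2} η(-Tr(γ^{p^l+1})) if Tr(γ^{p^l+1}) ≠ 0, while ψ_3(a) = ((p-1)^2/2) p^{e+m-3} if Tr(γ^{p^l+1}) = 0. -/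
open scoped BigOperators

noncomputable section

section
variable {F : Type*} [Field F] [Fintype F]

lemma aux_card_dvd (d k n : ℕ) (hd : d ∣ Fintype.card F - 1) (hn : n = d * k) {X : Type*}
    (T : F → X) (c : X) : d ∣ Nat.card {u : Fˣ // T ((u : F) ^ n) = c} := by
  classical
  set H : Subgroup Fˣ := (powMonoidHom d : Fˣ →* Fˣ).ker with hH
  have hcard : Nat.card H = d := by
    rw [hH, IsCyclic.card_powMonoidHom_ker, Nat.card_eq_fintype_card, Fintype.card_units]
    exact Nat.gcd_eq_right hd
  set A : Set Fˣ := {u : Fˣ | T ((u : F) ^ n) = c} with hA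
  have hpre : (QuotientGroup.mk : Fˣ → Fˣ ⧸ H) ⁻¹' ((QuotientGroup.mk : Fˣ → Fˣ ⧸ H) '' A) = A := by
    ext u
    constructor
    · rintro ⟨v, hv, huv⟩
      rw [QuotientGroup.eq] at huv
      have h1 : (v⁻¹ * u) ^ d = 1 := huv
      have h2 : u ^ d = v ^ d := by
        rw [mul_pow, inv_pow, inv_mul_eq_one] at h1; exact h1.symm
      have h3 : u ^ n = v ^ n := by rw [hn, pow_mul, pow_mul, h2]
      have h4 : (u : F) ^ n = (v : F) ^ n := by exact_mod_cast congrArg Units.val h3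
      show T ((u : F) ^ n) = c
      rw [h4]; exact hv
    · intro hu; exact ⟨u, hu, rfl⟩
  have := Nat.card_congr (QuotientGroup.preimageMkEquivSubgroupProdSet H
    ((QuotientGroup.mk : Fˣ → Fˣ ⧸ H) '' A))
  rw [hpre, Nat.card_prod, hcard] at this
  exact ⟨_, this⟩

lemma aux_exists_pow (d r : ℕ) (hd : d * r ∣ Fintype.card F - 1) (hr : 0 < r) (z : Fˣ)
    (hz : z ^ r = 1) : ∃ w : Fˣ, w ^ d = z := by
  classical
  obtain ⟨g, hg⟩ := IsCyclic.exists_generator (α := Fˣ)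
  have ho : orderOf g = Fintype.card F - 1 := by
    rw [orderOf_eq_card_of_forall_mem_zpowers hg, Nat.card_eq_fintype_card, Fintype.card_units]
  obtain ⟨i, rfl⟩ := (mem_powers_iff_mem_zpowers).2 (hg z)
  obtain ⟨t, ht⟩ := hd
  simp only at hz ⊢
  rw [← pow_mul, ← orderOf_dvd_iff_pow_eq_one, ho, ht] at hz
  have : d ∣ i := by
    have : d * r ∣ i * r := (Dvd.intro _ rfl).trans hz
    exact Nat.dvd_of_mul_dvd_mul_right hr this
  obtain ⟨j, rfl⟩ := this
  exact ⟨g ^ j, by rw [← pow_mul, mul_comm]⟩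
end

section
variable {p : ℕ} [Fact p.Prime] {F : Type*} [Field F] [Fintype F] [Algebra (ZMod p) F]

local notation "T" => Algebra.trace (ZMod p) F

lemma aux_trace_pow (n : ℕ) (x : F) : T (x ^ p ^ n) = T x := by
  have h := Algebra.trace_eq_of_algEquiv ((FiniteField.frobeniusAlgEquivOfAlgebraic (ZMod p) F)^n) x
  rw [AlgEquiv.coe_pow, FiniteField.coe_frobeniusAlgEquivOfAlgebraic_iterate, ZMod.card] at h
  exact h

lemma aux_char : CharP F p := by
  exact (Algebra.charP_iff (ZMod p) F p).1 inferInstance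

lemma aux_add_pow (n : ℕ) (x y : F) : (x + y) ^ p ^ n = x ^ p ^ n + y ^ p ^ n := by
  have : CharP F p := aux_char
  exact add_pow_char_pow x y p n

lemma aux_alg_pow (n : ℕ) (z : ZMod p) :
    (algebraMap (ZMod p) F z) ^ p ^ n = algebraMap (ZMod p) F z := by
  rw [← map_pow, ZMod.pow_card_pow]

lemma aux_T_mul (z : ZMod p) (x : F) : T (algebraMap (ZMod p) F z * x) = z * T x := by
  rw [← Algebra.smul_def, map_smul, smul_eq_mul]

/-- linearisation -/
lemma aux_Q_add (l : ℕ) (x y : F) :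
    T ((x + y) ^ (p ^ l + 1)) = T (x ^ (p ^ l + 1)) + T (y ^ (p ^ l + 1))
      + T ((y ^ p ^ (2 * l) + y) * x ^ p ^ l) := by
  have h1 : T (y ^ p ^ l * x) = T (y ^ p ^ (2 * l) * x ^ p ^ l) := by
    rw [← aux_trace_pow l (y ^ p ^ l * x), mul_pow, ← pow_mul, ← pow_add, two_mul]
  rw [pow_succ, aux_add_pow]
  have : (x ^ p ^ l + y ^ p ^ l) * (x + y) =
    x ^ (p ^ l + 1) + y ^ (p ^ l + 1) + y ^ p ^ l * x + y * x ^ p ^ l := by ring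
  rw [this, add_mul]
  simp only [map_add, h1]
  ring

lemma aux_Q_self (l : ℕ) (y : F) :
    T ((y ^ p ^ (2 * l) + y) * y ^ p ^ l) = 2 * T (y ^ (p ^ l + 1)) := by
  have h1 : T (y ^ p ^ l * y) = T (y ^ p ^ (2 * l) * y ^ p ^ l) := by
    rw [← aux_trace_pow l (y ^ p ^ l * y), mul_pow, ← pow_mul y (p ^ l) (p ^ l), ← pow_add p, two_mul]
  rw [add_mul, map_add, ← h1, pow_succ, mul_comm y, two_mul]

lemma aux_sum_char (b : F) (ψ : AddChar (ZMod p) ℂ) (hψ : ψ.IsPrimitive) (l : ℕ) :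
    b ≠ 0 → ∑ x : F, ψ (T (b * x ^ p ^ l)) = 0 := by
  intro hb
  have hinj : Function.Injective (fun x : F => x ^ p ^ l) := by
    have : CharP F p := aux_char
    exact iterateFrobenius_inj F p l
  have hbij : Function.Bijective (fun x : F => x ^ p ^ l) := Finite.injective_iff_bijective.1 hinj
  rw [Function.Bijective.sum_comp hbij (fun x => ψ (T (b * x)))]
  set φ : AddChar F ℂ := ψ.compAddMonoidHom ((T).toAddMonoidHom.comp (AddMonoidHom.mulLeft b))
  have hφ : ∀ x, φ x = ψ (T (b * x)) := fun x => rfl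
  simp_rw [← hφ]
  apply AddChar.sum_eq_zero_of_ne_one
  have : CharP F p := aux_char
  obtain ⟨y, hy⟩ : ∃ y, T (b * y) ≠ 0 := by
    by_contra! h
    have hr : ringChar F = p := ringChar.eq F p ▸ rfl
    apply hb
    apply (traceForm_nondegenerate (ZMod p) F).1
    intro y; exact h y
  intro h1
  have := hψ hy
  apply this
  ext c
  simp only [AddChar.mulShift_apply, AddChar.one_apply]
  have h2 : φ (algebraMap (ZMod p) F c * y) = 1 := by rw [h1]; rfl
  rw [hφ, mul_left_comm, aux_T_mul, mul_comm] at h2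
  exact h2

lemma aux_inj (l n' : ℕ) (hp : Odd p) (hn : Odd n') (e k : ℕ) (hF : Fintype.card F = p ^ e)
    (hk : 2 * l * n' = e * k) (y : F) (hy : y ^ p ^ (2 * l) + y = 0) : y = 0 := by
  have h0 : y ^ p ^ (2 * l) = - y := eq_neg_of_add_eq_zero_left hy
  have h1 : ∀ j, y ^ p ^ (2 * l * j) = (-1) ^ j * y := by
    intro j
    induction j with
    | zero => simp
    | succ j ih =>
      rw [mul_add, mul_one, pow_add, pow_mul, ih, mul_pow, h0, ← pow_mul, pow_succ, mul_comm j,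
        pow_mul, (hp.pow).neg_one_pow]
      ring
  have h2 := h1 n'
  rw [hk, pow_mul, ← hF, FiniteField.pow_card_pow, hn.neg_one_pow] at h2
  have : CharP F p := aux_char
  have h3 : (2 : F) * y = 0 := by linear_combination h2
  rcases mul_eq_zero.1 h3 with h | h
  · exfalso
    have : (p : ℕ) ∣ 2 := (CharP.cast_eq_zero_iff F p 2).1 (by exact_mod_cast h)
    have := (Nat.prime_dvd_prime_iff_eq (Fact.out) Nat.prime_two).1 this
    subst this; exact absurd hp (by decide)
  · exact h
lemma aux_norm (l l' s m' : ℕ) (hs : 0 < s) (hl : l = s * l') (hl' : Odd l')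
    (hF : Fintype.card F = p ^ (2 * s * m')) (z : ZMod p) (hz : z ≠ 0) :
    ∃ u : F, u ≠ 0 ∧ u ^ (p ^ l + 1) = algebraMap (ZMod p) F z := by
  have hp1 : 1 < p := (Fact.out : p.Prime).one_lt
  have hz' : algebraMap (ZMod p) F z ≠ 0 := by
    simpa using hz
  have hps : 1 < p ^ s := Nat.one_lt_pow hs.ne' hp1
  have hd : (p ^ s + 1) * (p ^ s - 1) ∣ Fintype.card F - 1 := by
    rw [hF, ← Nat.sq_sub_sq, ← pow_mul, one_pow]
    apply Nat.pow_sub_one_dvd_pow_sub_one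
    rw [mul_comm 2 s]; exact Dvd.intro _ rfl
  have hzz := aux_alg_pow (F := F) s z
  obtain ⟨w, hw⟩ := aux_exists_pow (F := F) (p ^ s + 1) (p ^ s - 1) hd (by omega)
    (Units.mk0 _ hz') (by
      ext
      simp only [Units.val_pow_eq_pow_val, Units.val_mk0, Units.val_one]
      apply mul_right_cancel₀ hz'
      rw [← pow_succ, Nat.sub_add_cancel hps.le, hzz, one_mul])
  have hw' : (w : F) ^ (p ^ s + 1) = algebraMap (ZMod p) F z := by
    have := congrArg Units.val hw
    simpa using this
  have h2 : (w : F) ^ p ^ (s * 2) = w := by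
    have h3 := hzz
    rw [← hw', pow_succ (w : F), mul_pow, ← pow_mul (w : F), ← pow_add p, ← mul_two,
      mul_comm ((w : F) ^ p ^ s)] at h3
    exact mul_right_cancel₀ (pow_ne_zero _ w.ne_zero) h3
  obtain ⟨j, rfl⟩ := hl'
  refine ⟨w, w.ne_zero, ?_⟩
  have h4 : ∀ i : ℕ, (w : F) ^ p ^ (s * (2 * i)) = w := by
    intro i
    induction i with
    | zero => simp
    | succ i ih => rw [show s * (2 * (i + 1)) = s * (2 * i) + s * 2 by ring, pow_add, pow_mul, ih, h2]
  rw [← hw', hl, pow_succ, pow_succ, mul_add, mul_one, pow_add, pow_mul, h4]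

lemma aux_S_scale (l : ℕ) (ψ : AddChar (ZMod p) ℂ) (z : ZMod p) (u : F) (hu : u ≠ 0)
    (huz : u ^ (p ^ l + 1) = algebraMap (ZMod p) F z) :
    ∑ x : F, ψ (z * T (x ^ (p ^ l + 1))) = ∑ x : F, ψ (T (x ^ (p ^ l + 1))) := by
  rw [← (mulLeft_bijective₀ u hu).sum_comp (fun x => ψ (T (x ^ (p ^ l + 1))))]
  simp only [mul_pow, huz, aux_T_mul]

lemma aux_S_sq (l : ℕ) (ψ : AddChar (ZMod p) ℂ) (hψ : ψ.IsPrimitive)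
    (hL : ∀ y : F, y ^ p ^ (2 * l) + y = 0 → y = 0) :
    (∑ x : F, ψ (T (x ^ (p ^ l + 1)))) * (∑ x : F, ψ ((-1) * T (x ^ (p ^ l + 1))))
      = Fintype.card F := by
  classical
  rw [Finset.sum_mul_sum, Finset.sum_comm]
  have h1 : ∀ y : F, ∑ x : F, ψ (T (x ^ (p ^ l + 1))) * ψ ((-1) * T (y ^ (p ^ l + 1)))
      = ∑ h : F, ψ (T (h ^ (p ^ l + 1))) * ψ (T ((h ^ p ^ (2 * l) + h) * y ^ p ^ l)) := by
    intro y
    rw [← (Equiv.addLeft y).bijective.sum_comp]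
    apply Finset.sum_congr rfl
    intro h _
    rw [Equiv.coe_addLeft, ← AddChar.map_add_eq_mul, ← AddChar.map_add_eq_mul, aux_Q_add]
    congr 1; ring
  simp_rw [h1]
  rw [Finset.sum_comm]
  simp_rw [← Finset.mul_sum]
  rw [Finset.sum_eq_single (0 : F)]
  · have hp0 : p ≠ 0 := (Fact.out : p.Prime).ne_zero
    simp [hp0]
  · intro h _ hh
    rw [aux_sum_char _ ψ hψ, mul_zero]
    exact fun h0 => hh (hL h h0)
  · simp

lemma aux_S_int (l d : ℕ) (ψ : AddChar (ZMod p) ℂ) (hψ : ψ.IsPrimitive)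
    (hd : d ∣ Fintype.card F - 1) (hdl : d ∣ p ^ l + 1)
    (hN : ∀ z : ZMod p, z ≠ 0 → ∃ u : F, u ≠ 0 ∧ u ^ (p ^ l + 1) = algebraMap (ZMod p) F z) :
    ∃ k : ℤ, ∑ x : F, ψ (T (x ^ (p ^ l + 1))) = ((1 + d * k : ℤ) : ℂ) := by
  classical
  obtain ⟨k, hk⟩ := hdl
  set N : ZMod p → ℕ := fun c => Nat.card {u : Fˣ // T ((u : F) ^ (p ^ l + 1)) = c} with hNdef
  have hNd : ∀ c, d ∣ N c := fun c => aux_card_dvd d k _ hd hk T c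
  have hNc : ∀ c, c ≠ 0 → N c = N 1 := by
    intro c hc
    obtain ⟨u, hu, huc⟩ := hN c hc
    symm
    apply Nat.card_congr
    refine (Equiv.mulLeft (Units.mk0 u hu)).subtypeEquiv ?_
    intro v
    simp only [Equiv.coe_mulLeft, Units.val_mul, Units.val_mk0, mul_pow, huc, aux_T_mul]
    constructor
    · intro h; rw [h, mul_one]
    · intro h; exact mul_left_cancel₀ hc (by rw [h, mul_one])
  have hp0 : p ≠ 0 := (Fact.out : p.Prime).ne_zero
  have h1 : ∑ x : F, ψ (T (x ^ (p ^ l + 1))) = 1 + ∑ u : Fˣ, ψ (T ((u : F) ^ (p ^ l + 1))) := by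
    rw [← Finset.add_sum_erase _ _ (Finset.mem_univ (0 : F))]
    congr 1
    · simp
    · symm
      refine Finset.sum_bij (fun u _ => (u : F)) ?_ ?_ ?_ ?_
      · intro u _; simp
      · intro u _ v _ h; exact Units.ext h
      · intro x hx; exact ⟨Units.mk0 x (Finset.ne_of_mem_erase hx), Finset.mem_univ _, rfl⟩
      · intro _ _; rfl
  have h2 : ∑ u : Fˣ, ψ (T ((u : F) ^ (p ^ l + 1))) = ∑ c : ZMod p, (N c : ℂ) * ψ c := by
    rw [← Finset.sum_fiberwise Finset.univ (fun u : Fˣ => T ((u : F) ^ (p ^ l + 1)))]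
    apply Finset.sum_congr rfl
    intro c _
    rw [Finset.sum_congr rfl (g := fun _ => ψ c)]
    · rw [Finset.sum_const, nsmul_eq_mul]
      congr 2
      rw [hNdef]
      simp only [Nat.card_eq_fintype_card, Fintype.card_subtype]
    · intro u hu; rw [(Finset.mem_filter.1 hu).2]
  have h3 : ∑ c : ZMod p, (N c : ℂ) * ψ c = N 0 - N 1 := by
    have h4 : ∑ c : ZMod p, ψ c = 0 := by
      have := AddChar.sum_mulShift (1 : ZMod p) hψ
      simpa using this
    rw [← Finset.add_sum_erase _ _ (Finset.mem_univ (0 : ZMod p))] at h4 ⊢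
    rw [Finset.sum_congr rfl (g := fun c => (N 1 : ℂ) * ψ c)]
    · rw [← Finset.mul_sum]
      rw [AddChar.map_zero_eq_one] at h4 ⊢
      linear_combination (N 1 : ℂ) * h4
    · intro c hc; rw [hNc c (Finset.ne_of_mem_erase hc)]
  obtain ⟨a, ha⟩ := hNd 0
  obtain ⟨b, hb⟩ := hNd 1
  refine ⟨a - b, ?_⟩
  rw [h1, h2, h3, ha, hb]
  push_cast; ring

lemma aux_S_val (l l' s m' : ℕ) (hp : Odd p) (hs : 0 < s) (hl : l = s * l') (hl' : Odd l')
    (hm' : Odd m') (hF : Fintype.card F = p ^ (2 * s * m')) (ψ : AddChar (ZMod p) ℂ)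
    (hψ : ψ.IsPrimitive) (z : ZMod p) (hz : z ≠ 0) :
    ∑ x : F, ψ (z * T (x ^ (p ^ l + 1))) = - (p : ℂ) ^ (s * m') := by
  have hp1 : 1 < p := (Fact.out : p.Prime).one_lt
  have hN := fun z hz => aux_norm (F := F) l l' s m' hs hl hl' hF z hz
  obtain ⟨u, hu, huz⟩ := hN z hz
  obtain ⟨v, hv, hvz⟩ := hN (-1) (neg_ne_zero.2 one_ne_zero)
  rw [aux_S_scale l ψ z u hu huz]
  have hL : ∀ y : F, y ^ p ^ (2 * l) + y = 0 → y = 0 := fun y hy =>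
    aux_inj l m' hp hm' (2 * s * m') l' hF (by rw [hl]; ring) y hy
  have hsq := aux_S_sq (F := F) l ψ hψ hL
  rw [aux_S_scale l ψ (-1) v hv hvz] at hsq
  have hdm : p ^ s + 1 ∣ p ^ (s * m') + 1 := by
    have := hm'.nat_add_dvd_pow_add_pow (p ^ s) 1
    rwa [one_pow, ← pow_mul] at this
  have hdl : p ^ s + 1 ∣ p ^ l + 1 := by
    have := hl'.nat_add_dvd_pow_add_pow (p ^ s) 1
    rwa [one_pow, ← pow_mul, ← hl] at this
  have hd : p ^ s + 1 ∣ Fintype.card F - 1 := by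
    have : p ^ (2 * s * m') - 1 = (p ^ (s * m') + 1) * (p ^ (s * m') - 1) := by
      rw [← Nat.sq_sub_sq, ← pow_mul, one_pow]; congr 2; ring
    rw [hF, this]; exact hdm.mul_right _
  obtain ⟨k, hk⟩ := aux_S_int (F := F) l (p ^ s + 1) ψ hψ hd hdl hN
  rw [hk, hF] at hsq
  rw [hk]
  have hsq' : (1 + ((p ^ s + 1 : ℕ) : ℤ) * k) ^ 2 = ((p : ℤ) ^ (s * m')) ^ 2 := by
    have : (1 + ((p ^ s + 1 : ℕ) : ℤ) * k) * (1 + ((p ^ s + 1 : ℕ) : ℤ) * k)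
      = (p : ℤ) ^ (2 * s * m') := by exact_mod_cast hsq
    rw [sq, this, ← pow_mul]; congr 1; ring
  rcases sq_eq_sq_iff_eq_or_eq_neg.1 hsq' with h | h
  · exfalso
    have h1 : ((p ^ s + 1 : ℕ) : ℤ) ∣ (p : ℤ) ^ (s * m') + 1 := by exact_mod_cast hdm
    have h2 : ((p ^ s + 1 : ℕ) : ℤ) ∣ ((2 : ℕ) : ℤ) := by
      rw [← h] at h1
      have := dvd_sub h1 (Dvd.intro k rfl)
      push_cast at this ⊢
      ring_nf at this ⊢
      exact this
    have h3 := Nat.le_of_dvd (by norm_num) (Int.natCast_dvd_natCast.1 h2)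
    have : 1 < p ^ s := Nat.one_lt_pow hs.ne' hp1
    omega
  · rw [h]; push_cast; ring

lemma aux_complete (l : ℕ) (ψ : AddChar (ZMod p) ℂ) (a γ : F)
    (hγ : γ ^ p ^ (2 * l) + γ = - a ^ p ^ l) (z1 z3 : ZMod p) (hz1 : z1 ≠ 0) :
    ∑ x : F, ψ (T (algebraMap (ZMod p) F z1 * x ^ (p ^ l + 1) + a * algebraMap (ZMod p) F z3 * x))
     = ψ (- (z3 ^ 2 / z1 * T (γ ^ (p ^ l + 1)))) * ∑ x : F, ψ (z1 * T (x ^ (p ^ l + 1))) := by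
  set c : F := algebraMap (ZMod p) F (z3 / z1) * γ with hc
  rw [← (Equiv.addRight c).bijective.sum_comp, Finset.mul_sum]
  apply Finset.sum_congr rfl
  intro x _
  rw [← AddChar.map_add_eq_mul]
  congr 1
  have hcL : c ^ p ^ (2 * l) + c = algebraMap (ZMod p) F (z3 / z1) * (- a ^ p ^ l) := by
    rw [hc, mul_pow, aux_alg_pow, ← hγ]; ring
  have hB : ∀ y : F, T ((c ^ p ^ (2 * l) + c) * y ^ p ^ l) = - (z3 / z1) * T (a * y) := by
    intro y
    rw [hcL, mul_assoc, aux_T_mul, neg_mul, ← mul_pow, map_neg, aux_trace_pow]; ring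
  have hQ := aux_Q_self (p := p) l c
  rw [hB] at hQ
  have hQc : T (c ^ (p ^ l + 1)) = (z3 / z1) ^ 2 * T (γ ^ (p ^ l + 1)) := by
    rw [hc, mul_pow, pow_succ, aux_alg_pow, ← map_mul, aux_T_mul, sq]
  rw [Equiv.coe_addRight, map_add, aux_T_mul, aux_Q_add, hB,
    show a * algebraMap (ZMod p) F z3 * (x + c) = algebraMap (ZMod p) F z3 * (a * x + a * c) by ring,
    aux_T_mul, map_add]
  have e1 : z3 * T (a * c) = - z1 * (2 * T (c ^ (p ^ l + 1))) := by
    rw [← hQ]; field_simp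
  rw [mul_add z3, e1, hQc]
  field_simp
  ring
end

section
variable {p : ℕ} [Fact p.Prime]

lemma aux_final (ψ : AddChar (ZMod p) ℂ) (hψ : ψ.IsPrimitive) (t : ZMod p) :
    ∑ z1 ∈ ({0}ᶜ : Finset (ZMod p)), ψ (-z1) *
      ∑ z3 ∈ ({0}ᶜ : Finset (ZMod p)), ψ (- (z3 ^ 2 / z1 * t))
    = p * (({z : ZMod p | 1 + z ^ 2 * t = 0} : Finset (ZMod p)).card : ℂ) - (p - 1) := by
  have h1 : ∀ z1 ∈ ({0}ᶜ : Finset (ZMod p)), ψ (-z1) *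
      ∑ z3 ∈ ({0}ᶜ : Finset (ZMod p)), ψ (- (z3 ^ 2 / z1 * t)) =
      ∑ z3 ∈ ({0}ᶜ : Finset (ZMod p)), ψ (z1 * (-(1 + z3 ^ 2 * t))) := by
    intro z1 hz
    have hz1 : z1 ≠ 0 := by simpa using hz
    rw [Finset.mul_sum]
    symm
    refine Finset.sum_bij (fun z _ => z1 * z) ?_ ?_ ?_ ?_
    · intro z hz; simp_all
    · intro z _ w _ h; exact mul_left_cancel₀ hz1 h
    · intro z hz
      refine ⟨z / z1, ?_, ?_⟩
      · simp_all
      · field_simp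
    · intro z _
      rw [← AddChar.map_add_eq_mul]
      congr 1
      field_simp
      ring
  rw [Finset.sum_congr rfl h1, Finset.sum_comm]
  have h2 : ∀ b : ZMod p, ∑ z1 ∈ ({0}ᶜ : Finset (ZMod p)), ψ (z1 * (-b))
      = (if b = 0 then (p : ℂ) else 0) - 1 := by
    intro b
    have h := AddChar.sum_mulShift (-b) hψ
    rw [← Finset.add_sum_erase _ _ (Finset.mem_univ (0 : ZMod p))] at h
    have hE : ({0}ᶜ : Finset (ZMod p)) = Finset.univ.erase 0 := by ext; simp
    rw [hE]
    simp only [zero_mul, AddChar.map_zero_eq_one, neg_eq_zero, ZMod.card] at h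
    rw [eq_sub_iff_add_eq', h]
    split_ifs <;> simp
  simp_rw [h2]
  rw [Finset.sum_sub_distrib, ← Finset.sum_filter, Finset.sum_const, Finset.sum_const,
    Finset.card_compl, Finset.card_singleton, ZMod.card]
  have h3 : ({x ∈ ({0}ᶜ : Finset (ZMod p)) | 1 + x ^ 2 * t = 0}) =
    ({z : ZMod p | 1 + z ^ 2 * t = 0} : Finset (ZMod p)) := by
    ext x
    simp only [Finset.mem_filter, Finset.mem_compl, Finset.mem_singleton, Finset.mem_univ, true_and]
    constructor
    · exact fun h => h.2
    · intro h
      refine ⟨?_, h⟩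
      rintro rfl
      simp at h
  rw [h3]
  have hp1 : 1 ≤ p := (Fact.out : p.Prime).one_lt.le
  simp only [nsmul_eq_mul, Nat.cast_sub hp1]
  push_cast
  ring
end

lemma aux_zeta (p : ℕ) [Fact p.Prime] (x : ZMod p) :
    zetaP p ^ x.val = ZMod.stdAddChar x := by
  have h := ZMod.stdAddChar_coe (N := p) (x.val : ℤ)
  rw [Int.cast_natCast, ZMod.natCast_zmod_val] at h
  rw [h, zetaP, ← Complex.exp_nat_mul]
  congr 1
  push_cast
  ring

lemma aux_count (p : ℕ) [Fact p.Prime] (hp : Odd p) (t : ZMod p) (ht : t ≠ 0) :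
    ((({z : ZMod p | 1 + z ^ 2 * t = 0} : Finset (ZMod p)).card : ℤ)) = 1 + eta p (-t) := by
  have hr : ringChar (ZMod p) ≠ 2 := by
    rw [ZMod.ringChar_zmod_n]
    rintro rfl
    exact absurd hp (by decide)
  have h := quadraticChar_card_sqrts hr (-t)
  have h1 : (({z : ZMod p | 1 + z ^ 2 * t = 0} : Finset (ZMod p)).card) =
      ({x : ZMod p | x ^ 2 = -t} : Set (ZMod p)).toFinset.card := by
    refine Finset.card_bij (fun z _ => z * t) ?_ ?_ ?_
    · intro z hz
      have hz' : 1 + z ^ 2 * t = 0 := by simpa using hz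
      simp only [Set.mem_toFinset, Set.mem_ofPred_eq]
      linear_combination t * hz'
    · intro z _ w _ hzw; exact mul_right_cancel₀ ht hzw
    · intro x hx
      have hx' : x ^ 2 = -t := by simpa using hx
      refine ⟨x / t, ?_, ?_⟩
      · simp only [Finset.mem_filter, Finset.mem_univ, true_and]
        field_simp
        rw [hx']; ring
      · field_simp
  rw [h1, h, add_comm]
  congr 1
  have hnt : -t ≠ 0 := neg_ne_zero.2 ht
  rw [eta, if_neg hnt]
  rw [quadraticChar_apply, quadraticCharFun, if_neg hnt]
  split_ifs <;> rfl

lemma aux_psi (p e l m s : ℕ) [Fact p.Prime] (hp : Odd p)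
    (hl : 0 < l) (he : e = 2 * m) (hs : s = Nat.gcd l e) (hm : 1 ≤ m)
    (hsm : s ∣ m) (hodd : Odd (m / s)) (a : GaloisField p e) :
    (∀ y : GaloisField p e, y ^ p ^ (2 * l) + y = 0 → y = 0) ∧
    ∀ γ : GaloisField p e, γ ^ p ^ (2 * l) + γ = -a ^ p ^ l →
      psi3 p e l a = ((p : ℂ) - 1) / 2 * (p : ℂ) ^ ((e : ℤ) - 3) * (- (p : ℂ) ^ m *
        (p * (({z : ZMod p | 1 + z ^ 2 * tr p e (γ ^ (p ^ l + 1)) = 0} : Finset (ZMod p)).card : ℂ)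
          - (p - 1))) := by
  have hspos : 0 < s := by rw [hs]; exact Nat.gcd_pos_of_pos_left _ hl
  obtain ⟨m', hm'⟩ := hsm
  obtain ⟨l', hl'⟩ : s ∣ l := by rw [hs]; exact Nat.gcd_dvd_left _ _
  have hmo : Odd m' := by rwa [hm', Nat.mul_div_cancel_left _ hspos] at hodd
  have hlo : Odd l' := by
    rw [← Nat.not_even_iff_odd]
    rintro ⟨k, hk⟩
    have h1 : s * 2 ∣ Nat.gcd l e := by
      apply Nat.dvd_gcd
      · exact ⟨k, by rw [hl', hk]; ring⟩
      · exact ⟨m', by rw [he, hm']; ring⟩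
    rw [← hs] at h1
    have := Nat.le_of_dvd hspos h1
    omega
  letI : Fintype (GaloisField p e) := Fintype.ofFinite _
  have he' : e = 2 * s * m' := by rw [he, hm']; ring
  have hF : Fintype.card (GaloisField p e) = p ^ (2 * s * m') := by
    rw [← Nat.card_eq_fintype_card, GaloisField.card p e (by omega), he']
  refine ⟨fun y hy => aux_inj (p := p) l m' hp hmo (2 * s * m') l' hF (by rw [hl']; ring) y hy, ?_⟩
  intro γ hγ
  have hψ := ZMod.isPrimitive_stdAddChar p
  rw [psi3]
  congr 1
  rw [← aux_final _ hψ, Finset.mul_sum]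
  apply Finset.sum_congr rfl
  intro z1 hz
  have hz1 : z1 ≠ 0 := by simpa using hz
  rw [aux_zeta, mul_left_comm]
  congr 1
  rw [Finset.mul_sum]
  apply Finset.sum_congr rfl
  intro z3 _
  rw [weilSum]
  simp only [aux_zeta]
  have h1 := aux_complete (p := p) l ZMod.stdAddChar a γ hγ z1 z3 hz1
  rw [aux_S_val l l' s m' hp hspos hl' hlo hmo hF _ hψ z1 hz1, ← hm'] at h1
  exact h1.trans (mul_comm _ _)

/-- the value of `ψ_3(a)` for `a ≠ 0` when `m/s` is odd (paper Lemma 10). -/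
theorem psi3_eval_odd (p e l m s : ℕ) [Fact p.Prime] (hp : Odd p)
    (hl : 0 < l) (hm : 1 ≤ m) (he : e = 2 * m) (hs : s = Nat.gcd l e)
    (hsm : s ∣ m) (hodd : Odd (m / s)) (a : GaloisField p e) (ha : a ≠ 0) :
    (∃! γ : GaloisField p e, γ ^ p ^ (2 * l) + γ = -a ^ p ^ l) ∧
    ∀ γ : GaloisField p e, γ ^ p ^ (2 * l) + γ = -a ^ p ^ l →
      (tr p e (γ ^ (p ^ l + 1)) ≠ 0 →
        psi3 p e l a =
          -(((p : ℂ) - 1) / 2) * (p : ℂ) ^ ((e : ℤ) + m - 3) -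
            ((p : ℂ) - 1) / 2 * (p : ℂ) ^ ((e : ℤ) + m - 2) *
              ((eta p (-(tr p e (γ ^ (p ^ l + 1)))) : ℤ) : ℂ)) ∧
      (tr p e (γ ^ (p ^ l + 1)) = 0 →
        psi3 p e l a = ((p : ℂ) - 1) ^ 2 / 2 * (p : ℂ) ^ ((e : ℤ) + m - 3)) := by
  have hp0 : (p : ℂ) ≠ 0 := by exact_mod_cast (Fact.out : p.Prime).ne_zero
  obtain ⟨hL, hpsi⟩ := aux_psi p e l m s hp hl he hs hm hsm hodd a
  have hinj : Function.Injective (fun y : GaloisField p e => y ^ p ^ (2 * l) + y) := by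
    intro x y hxy
    simp only at hxy
    have h : (x - y) ^ p ^ (2 * l) + (x - y) = 0 := by
      rw [sub_pow_char_pow (p := p) (n := 2 * l) (x := x) (y := y)]
      linear_combination hxy
    exact sub_eq_zero.1 (hL _ h)
  refine ⟨?_, ?_⟩
  · obtain ⟨γ, hγ⟩ := (Finite.injective_iff_surjective.1 hinj) (-a ^ p ^ l)
    exact ⟨γ, hγ, fun y hy => hinj (hy.trans hγ.symm)⟩
  · intro γ hγ
    rw [hpsi γ hγ]
    have e1 : (p : ℂ) ^ ((e : ℤ) + m - 3) = (p : ℂ) ^ ((e : ℤ) - 3) * (p : ℂ) ^ m := by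
      rw [← zpow_natCast, ← zpow_add₀ hp0]; congr 1; ring
    have e2 : (p : ℂ) ^ ((e : ℤ) + m - 2) = (p : ℂ) ^ ((e : ℤ) - 3) * (p : ℂ) ^ m * p := by
      rw [← e1, ← zpow_add_one₀ hp0]; congr 1; ring
    rw [e1, e2]
    refine ⟨fun ht => ?_, fun ht => ?_⟩
    · have hc := aux_count p hp _ ht
      have hc' : ((({z : ZMod p | 1 + z ^ 2 * tr p e (γ ^ (p ^ l + 1)) = 0} :
          Finset (ZMod p)).card : ℂ)) = 1 + ((eta p (-(tr p e (γ ^ (p ^ l + 1)))) : ℤ) : ℂ) := by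
        exact_mod_cast hc
      rw [hc']
      ring
    · rw [ht]
      simp
      ring

end
end
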